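/- arXiv:1705.00418 — 7 statements merged into one kernel-verified Lean document; each statement's English description precedes it below -/
import Mathlib

section
/- Let s ∈ ℝ with s > 2. There exists a constant C > 0 (depending only on s) such that for all finitely supported functions a, u : ℤ² → ℂ one has (Σ_{k∈ℤ²} |Σ_{m∈ℤ²} a(k−m)(⟨k⟩^s − ⟨m⟩^s) u(m)|²)^{1/2} ≤ C (Σ_{k∈ℤ²} ⟨k⟩^{2s}|a(k)|²)^{1/2} (Σ_{k∈ℤ²} ⟨k⟩^{2(s−1)}|u(k)|²)^{1/2}. (This is the Fourier-coefficient form of the commutator estimate ‖[a, ⟨∇⟩^s]u‖_{L²(𝕋²)} ≤ C‖a‖_{H^s(𝕋²)}‖u‖_{H^{s−1}(𝕋²)}.) -/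
/-- The "Japanese bracket" ⟨k⟩ = (1 + k₁² + k₂²)^{1/2} for k ∈ ℤ². -/
noncomputable def jap (k : ℤ × ℤ) : ℝ := Real.sqrt (1 + (k.1 : ℝ) ^ 2 + (k.2 : ℝ) ^ 2)

theorem one_le_jap (k : ℤ × ℤ) : 1 ≤ jap k := by
  unfold jap
  rw [Real.one_le_sqrt]
  nlinarith [sq_nonneg (k.1 : ℝ), sq_nonneg (k.2 : ℝ)]

theorem jap_pos (k : ℤ × ℤ) : 0 < jap k := one_pos.trans_le (one_le_jap k)

theorem jap_neg (k : ℤ × ℤ) : jap (-k) = jap k := by simp [jap]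

theorem jap_sq (k : ℤ × ℤ) : jap k ^ 2 = 1 + (k.1 : ℝ) ^ 2 + (k.2 : ℝ) ^ 2 :=
  Real.sq_sqrt (by positivity)

theorem jap_add_le (k m : ℤ × ℤ) : jap (k + m) ≤ jap k + jap m := by
  have hcross : (k.1 : ℝ) * m.1 + k.2 * m.2 ≤ jap k * jap m := by
    refine le_of_sq_le_sq ?_ (mul_pos (jap_pos k) (jap_pos m)).le
    rw [mul_pow, jap_sq, jap_sq]
    nlinarith [sq_nonneg ((k.1 : ℝ) * m.2 - k.2 * m.1), sq_nonneg (k.1 : ℝ),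
      sq_nonneg (k.2 : ℝ), sq_nonneg (m.1 : ℝ), sq_nonneg (m.2 : ℝ)]
  refine le_of_sq_le_sq ?_ (add_pos (jap_pos k) (jap_pos m)).le
  have hkm := jap_sq (k + m)
  push_cast [Prod.fst_add, Prod.snd_add] at hkm
  nlinarith [jap_sq k, jap_sq m]

theorem abs_jap_sub_jap_le (k m : ℤ × ℤ) : |jap k - jap m| ≤ jap (k - m) := by
  have h₁ := jap_add_le (k - m) m
  have h₂ := jap_add_le (m - k) k
  rw [← jap_neg (m - k), neg_sub] at h₂
  rw [sub_add_cancel] at h₁ h₂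
  rw [abs_le]
  constructor <;> linarith

theorem abs_rpow_sub_rpow_le {s x y M : ℝ} (hs : 1 ≤ s) (hx : 0 < x) (hy : 0 < y)
    (hxM : x ≤ M) (hyM : y ≤ M) : |x ^ s - y ^ s| ≤ s * M ^ (s - 1) * |x - y| := by
  refine (convex_Ioc 0 M).norm_image_sub_le_of_norm_hasDerivWithin_le
    (f := fun t : ℝ => t ^ s) (f' := fun t => s * t ^ (s - 1)) (fun t ht => ?_)
    (fun t ht => ?_) ⟨hy, hyM⟩ ⟨hx, hxM⟩
  · exact (Real.hasDerivAt_rpow_const (Or.inl ht.1.ne')).hasDerivWithinAt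
  · have h0 : 0 ≤ t ^ (s - 1) := Real.rpow_nonneg ht.1.le _
    rw [Real.norm_of_nonneg (by positivity)]
    gcongr
    · exact ht.1.le
    · exact ht.2

theorem add_rpow_le_two_rpow_mul {p x y : ℝ} (hp : 0 ≤ p) (hx : 0 ≤ x) (hy : 0 ≤ y) :
    (x + y) ^ p ≤ 2 ^ p * (x ^ p + y ^ p) := by
  have hx' := Real.rpow_nonneg hx p
  have hy' := Real.rpow_nonneg hy p
  rcases le_total x y with h | h
  · calc (x + y) ^ p ≤ (2 * y) ^ p := by gcongr; linarith
      _ = 2 ^ p * y ^ p := Real.mul_rpow zero_le_two hy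
      _ ≤ _ := by gcongr; linarith
  · calc (x + y) ^ p ≤ (2 * x) ^ p := by gcongr; linarith
      _ = 2 ^ p * x ^ p := Real.mul_rpow zero_le_two hx
      _ ≤ _ := by gcongr; linarith

theorem abs_jap_rpow_sub_le {s : ℝ} (hs : 1 ≤ s) (k m : ℤ × ℤ) :
    |jap k ^ s - jap m ^ s| ≤ s * 2 ^ (s - 1) *
      (jap (k - m) ^ s * jap m ^ (s - 1) * (jap (k - m) ^ (1 - s) + jap m ^ (1 - s))) := by
  have hn := jap_pos (k - m)
  have hm := jap_pos m
  have hk : jap k ≤ jap (k - m) + jap m := by simpa using jap_add_le (k - m) m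
  have e₁ : jap (k - m) ^ s * jap (k - m) ^ (1 - s) = jap (k - m) := by
    rw [← Real.rpow_add hn]; simp
  have e₂ : jap m ^ (s - 1) * jap m ^ (1 - s) = 1 := by
    rw [← Real.rpow_add hm]; simp
  have e₃ : jap (k - m) ^ s = jap (k - m) ^ (s - 1) * jap (k - m) := by
    rw [← Real.rpow_add_one hn.ne', sub_add_cancel]
  calc |jap k ^ s - jap m ^ s|
      ≤ s * (jap (k - m) + jap m) ^ (s - 1) * |jap k - jap m| :=
        abs_rpow_sub_rpow_le hs (jap_pos k) hm hk (by linarith)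
    _ ≤ s * (2 ^ (s - 1) * (jap (k - m) ^ (s - 1) + jap m ^ (s - 1))) * jap (k - m) := by
        gcongr
        · exact add_rpow_le_two_rpow_mul (by linarith) hn.le hm.le
        · exact abs_jap_sub_jap_le k m
    _ = s * 2 ^ (s - 1) * (jap m ^ (s - 1) * (jap (k - m) ^ s * jap (k - m) ^ (1 - s))
          + jap (k - m) ^ s * (jap m ^ (s - 1) * jap m ^ (1 - s))) := by
        rw [e₁, e₂, e₃]; ring
    _ = _ := by ring

theorem summable_jap_rpow {r : ℝ} (hr : 2 < r) : Summable fun k : ℤ × ℤ => jap k ^ (-r) := by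
  rw [← (finTwoArrowEquiv ℤ).summable_iff]
  refine Summable.of_nonneg_of_le (fun x => Real.rpow_nonneg (jap_pos _).le _) (fun x => ?_)
    ((EisensteinSeries.summable_one_div_norm_rpow hr).add
      (hasSum_ite_eq (0 : Fin 2 → ℤ) (1 : ℝ)).summable)
  by_cases hx : x = 0
  · have hone : jap (finTwoArrowEquiv ℤ x) ^ (-r) ≤ 1 :=
      Real.rpow_le_one_of_one_le_of_nonpos (one_le_jap _) (by linarith)
    have hnorm : 0 ≤ ‖x‖ ^ (-r) := Real.rpow_nonneg (norm_nonneg x) _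
    rw [Function.comp_apply, if_pos hx]
    linarith
  · have hle : ‖x‖ ≤ jap (finTwoArrowEquiv ℤ x) := by
      refine (pi_norm_le_iff_of_nonneg (jap_pos _).le).2 fun i => ?_
      rw [Int.norm_eq_abs]
      refine Real.abs_le_sqrt ?_
      fin_cases i <;> simp <;> nlinarith [sq_nonneg (x 0 : ℝ), sq_nonneg (x 1 : ℝ)]
    simpa [hx] using Real.rpow_le_rpow_of_nonpos (norm_pos_iff.2 hx) hle (by linarith)

/-- Discrete bilinear estimate: if `w` is square summable, then a kernel dominated by
`w (k - m) + w m` maps `ℓ² × ℓ²` to `ℓ²` by convolution. -/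
theorem sum_sq_convolution_le {G : Type*} [AddCommGroup G] {w A U : G → ℝ}
    (hw : Summable fun k => w k ^ 2) (hA : Summable fun k => A k ^ 2)
    (hU : Summable fun k => U k ^ 2) (H F : Finset G) :
    ∑ k ∈ H, (∑ m ∈ F, A (k - m) * U m * (w (k - m) + w m)) ^ 2
      ≤ 4 * (∑' k, w k ^ 2) * (∑' k, A k ^ 2) * ∑' k, U k ^ 2 := by
  set S := ∑' k, w k ^ 2
  have hS : 0 ≤ S := tsum_nonneg fun _ => sq_nonneg _
  have hweight (k : G) : ∑ m ∈ F, (w (k - m) + w m) ^ 2 ≤ 4 * S := by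
    have h₁ : ∑ m ∈ F, w (k - m) ^ 2 ≤ S :=
      (((Equiv.subLeft k).summable_iff.2 hw).sum_le_tsum F fun _ _ => sq_nonneg _).trans_eq
        ((Equiv.subLeft k).tsum_eq fun k => w k ^ 2)
    have h₂ : ∑ m ∈ F, w m ^ 2 ≤ S := hw.sum_le_tsum F fun _ _ => sq_nonneg _
    calc ∑ m ∈ F, (w (k - m) + w m) ^ 2
        ≤ ∑ m ∈ F, (2 * w (k - m) ^ 2 + 2 * w m ^ 2) :=
          Finset.sum_le_sum fun m _ => by nlinarith [sq_nonneg (w (k - m) - w m)]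
      _ = 2 * ∑ m ∈ F, w (k - m) ^ 2 + 2 * ∑ m ∈ F, w m ^ 2 := by
          rw [Finset.sum_add_distrib, Finset.mul_sum, Finset.mul_sum]
      _ ≤ 4 * S := by linarith
  have hshift (m : G) : ∑ k ∈ H, A (k - m) ^ 2 ≤ ∑' k, A k ^ 2 :=
    (((Equiv.subRight m).summable_iff.2 hA).sum_le_tsum H fun _ _ => sq_nonneg _).trans_eq
      ((Equiv.subRight m).tsum_eq fun k => A k ^ 2)
  calc ∑ k ∈ H, (∑ m ∈ F, A (k - m) * U m * (w (k - m) + w m)) ^ 2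
      ≤ ∑ k ∈ H, (∑ m ∈ F, (A (k - m) * U m) ^ 2) * ∑ m ∈ F, (w (k - m) + w m) ^ 2 :=
        Finset.sum_le_sum fun k _ => Finset.sum_mul_sq_le_sq_mul_sq _ _ _
    _ ≤ ∑ k ∈ H, (∑ m ∈ F, (A (k - m) * U m) ^ 2) * (4 * S) :=
        Finset.sum_le_sum fun k _ => mul_le_mul_of_nonneg_left (hweight k)
          (Finset.sum_nonneg fun _ _ => sq_nonneg _)
    _ = 4 * S * ∑ m ∈ F, (∑ k ∈ H, A (k - m) ^ 2) * U m ^ 2 := by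
        rw [← Finset.sum_mul, Finset.sum_comm, mul_comm]
        simp only [mul_pow, Finset.sum_mul]
    _ ≤ 4 * S * ∑ m ∈ F, (∑' k, A k ^ 2) * U m ^ 2 := by
        gcongr with m _
        exact hshift m
    _ = 4 * S * (∑' k, A k ^ 2) * ∑ m ∈ F, U m ^ 2 := by
        rw [← Finset.mul_sum]
        ring
    _ ≤ _ := by
        have : 0 ≤ ∑' k, A k ^ 2 := tsum_nonneg fun _ => sq_nonneg _
        gcongr
        exact hU.sum_le_tsum F fun _ _ => sq_nonneg _

/-- Fourier-coefficient form of the commutator estimate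
`‖[a, ⟨∇⟩^s]u‖_{L²(𝕋²)} ≤ C ‖a‖_{H^s(𝕋²)} ‖u‖_{H^{s-1}(𝕋²)}` for `s > 2`. -/
theorem commutator_estimate_fourier (s : ℝ) (hs : 2 < s) :
    ∃ C : ℝ, 0 < C ∧
      ∀ a u : (ℤ × ℤ) → ℂ,
        (Function.support a).Finite → (Function.support u).Finite →
        (∑' k : ℤ × ℤ,
            ‖∑' m : ℤ × ℤ, a (k - m) * (((jap k ^ s - jap m ^ s : ℝ)) : ℂ) * u m‖ ^ 2)
              ^ (1 / 2 : ℝ)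
          ≤ C * (∑' k : ℤ × ℤ, jap k ^ (2 * s) * ‖a k‖ ^ 2) ^ (1 / 2 : ℝ)
              * (∑' k : ℤ × ℤ, jap k ^ (2 * (s - 1)) * ‖u k‖ ^ 2) ^ (1 / 2 : ℝ) := by
  have hsq (t : ℝ) (k : ℤ × ℤ) : jap k ^ (2 * t) = (jap k ^ t) ^ 2 := by
    rw [mul_comm, Real.rpow_mul (jap_pos k).le, Real.rpow_two]
  have hw : Summable fun k : ℤ × ℤ => (jap k ^ (1 - s)) ^ 2 := by
    refine (summable_jap_rpow (r := 2 * (s - 1)) (by linarith)).congr fun k => ?_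
    rw [← hsq]
    congr 1
    ring
  set S := ∑' k : ℤ × ℤ, (jap k ^ (1 - s)) ^ 2
  have hS : 0 < S :=
    hw.tsum_pos (fun _ => sq_nonneg _) 0 (pow_pos (Real.rpow_pos_of_pos (jap_pos 0) _) 2)
  set K := s * 2 ^ (s - 1)
  have hK : 0 < K := by positivity
  refine ⟨(K ^ 2 * (4 * S)) ^ (1 / 2 : ℝ), by positivity, fun a u ha hu => ?_⟩
  simp only [hsq, ← mul_pow]
  set A : ℤ × ℤ → ℝ := fun k => jap k ^ s * ‖a k‖
  set U : ℤ × ℤ → ℝ := fun k => jap k ^ (s - 1) * ‖u k‖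
  have hA : Summable fun k => A k ^ 2 :=
    summable_of_hasFiniteSupport (ha.subset fun k hk h => hk (by simp [A, h]))
  have hU : Summable fun k => U k ^ 2 :=
    summable_of_hasFiniteSupport (hu.subset fun k hk h => hk (by simp [U, h]))
  have hA0 : 0 ≤ ∑' k, A k ^ 2 := tsum_nonneg fun _ => sq_nonneg _
  have hU0 : 0 ≤ ∑' k, U k ^ 2 := tsum_nonneg fun _ => sq_nonneg _
  rw [← Real.mul_rpow (by positivity) hA0, ← Real.mul_rpow (by positivity) hU0]
  refine Real.rpow_le_rpow (tsum_nonneg fun _ => sq_nonneg _) ?_ (by norm_num)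
  refine Real.tsum_le_of_sum_le (fun _ => sq_nonneg _) fun H => ?_
  have hpoint (k : ℤ × ℤ) :
      ‖∑' m : ℤ × ℤ, a (k - m) * (((jap k ^ s - jap m ^ s : ℝ)) : ℂ) * u m‖
        ≤ K * ∑ m ∈ hu.toFinset, A (k - m) * U m * (jap (k - m) ^ (1 - s) + jap m ^ (1 - s)) := by
    rw [tsum_eq_sum (s := hu.toFinset) fun m hm => by
      rw [Set.Finite.mem_toFinset, Function.notMem_support] at hm
      rw [hm, mul_zero], Finset.mul_sum]
    refine norm_sum_le_of_le _ fun m _ => ?_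
    rw [norm_mul, norm_mul, Complex.norm_real, Real.norm_eq_abs]
    calc ‖a (k - m)‖ * |jap k ^ s - jap m ^ s| * ‖u m‖
        ≤ ‖a (k - m)‖ * (K * (jap (k - m) ^ s * jap m ^ (s - 1) *
            (jap (k - m) ^ (1 - s) + jap m ^ (1 - s)))) * ‖u m‖ := by
          gcongr
          exact abs_jap_rpow_sub_le (by linarith) k m
      _ = _ := by ring
  calc _ ≤ ∑ k ∈ H, (K * ∑ m ∈ hu.toFinset,
        A (k - m) * U m * (jap (k - m) ^ (1 - s) + jap m ^ (1 - s))) ^ 2 := by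
        gcongr with k _
        exact hpoint k
    _ = K ^ 2 * ∑ k ∈ H, (∑ m ∈ hu.toFinset,
        A (k - m) * U m * (jap (k - m) ^ (1 - s) + jap m ^ (1 - s))) ^ 2 := by
        simp_rw [mul_pow K]
        rw [Finset.mul_sum]
    _ ≤ K ^ 2 * (4 * S * (∑' k, A k ^ 2) * ∑' k, U k ^ 2) := by
        gcongr
        exact sum_sq_convolution_le hw hA hU H hu.toFinset
    _ = _ := by ring
end

section
/- Let f : ℝ² → ℝ be C² and let v = (v₁,v₂,v₃) be a C¹ vector field on an open subset of ℝ³ containing the graph Γ_f. Then for every x' ∈ ℝ²: ((v·∇)v)̲(x') · N_f(x') − ((∂₃v)̲(x') · N_f(x')) · (v̲(x') · N_f(x')) = v̲₁(x') ∂₁(v̲·N_f)(x') + v̲₂(x') ∂₂(v̲·N_f)(x') + Σ_{i,j=1,2} v̲ᵢ(x') v̲ⱼ(x') ∂ᵢ∂ⱼf(x'). -/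
noncomputable section

abbrev P2 : Type := ℝ × ℝ
abbrev P3 : Type := ℝ × ℝ × ℝ

/-- Standard basis of ℝ³. -/
def e3 : Fin 3 → P3 := ![(1, 0, 0), (0, 1, 0), (0, 0, 1)]

/-- Components of a vector in ℝ³. -/
def c3 : Fin 3 → P3 → ℝ := ![fun a => a.1, fun a => a.2.1, fun a => a.2.2]

/-- Euclidean dot product on ℝ³. -/
def dot3 (a b : P3) : ℝ := a.1 * b.1 + a.2.1 * b.2.1 + a.2.2 * b.2.2

/-- Partial derivative ∂ᵢ of a scalar function on ℝ³. -/
def pd3 (i : Fin 3) (g : P3 → ℝ) (x : P3) : ℝ := fderiv ℝ g x (e3 i)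

/-- Partial derivative ∂ᵢ of a vector field on ℝ³. -/
def pdv3 (i : Fin 3) (v : P3 → P3) (x : P3) : P3 := fderiv ℝ v x (e3 i)

/-- The advective derivative (a·∇)v = Σ_k a_k ∂_k v. -/
def adv3 (a v : P3 → P3) (x : P3) : P3 := ∑ i : Fin 3, c3 i (a x) • pdv3 i v x

/-- Standard basis of ℝ². -/
def e2 : Fin 2 → P2 := ![(1, 0), (0, 1)]

/-- Partial derivative ∂ᵢ of a scalar function on ℝ². -/
def pd2 (i : Fin 2) (g : P2 → ℝ) (x : P2) : ℝ := fderiv ℝ g x (e2 i)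

/-- The point (x', f(x')) on the graph Γ_f. -/
def gr (f : P2 → ℝ) (x : P2) : P3 := (x.1, x.2, f x)

/-- The (non-unit) normal N_f = (−∂₁f, −∂₂f, 1) of the graph Γ_f. -/
def Nf (f : P2 → ℝ) (x : P2) : P3 := (-(pd2 0 f x), -(pd2 1 f x), 1)

theorem fderiv_dot3_apply {a b : P2 → P3} {a' b' : P2 →L[ℝ] P3} {x : P2}
    (ha : HasFDerivAt a a' x) (hb : HasFDerivAt b b' x) (h : P2) :
    fderiv ℝ (fun y => dot3 (a y) (b y)) x h = dot3 (a' h) (b x) + dot3 (a x) (b' h) := by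
  have key := ((ha.fst.mul hb.fst).add (ha.snd.fst.mul hb.snd.fst)).add
    (ha.snd.snd.mul hb.snd.snd)
  have hfd : fderiv ℝ (fun y => dot3 (a y) (b y)) x = _ := key.fderiv
  rw [hfd]
  simp [dot3]
  ring

theorem pd2_dot3_trace_Nf {f : P2 → ℝ} (hf : ContDiff ℝ 2 f) {v : P3 → P3} {x : P2}
    (hv : DifferentiableAt ℝ v (gr f x)) (i : Fin 2) :
    pd2 i (fun y => dot3 (v (gr f y)) (Nf f y)) x
      = dot3 (pdv3 i.castSucc v (gr f x) + pd2 i f x • pdv3 2 v (gr f x)) (Nf f x)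
        - ∑ j : Fin 2, c3 j.castSucc (v (gr f x)) * pd2 i (fun y => pd2 j f y) x := by
  have hfx : HasFDerivAt f (fderiv ℝ f x) x := (hf.differentiable (by norm_num) x).hasFDerivAt
  have hpd (j : Fin 2) : HasFDerivAt (pd2 j f) (fderiv ℝ (pd2 j f) x) x :=
    ((((hf.fderiv_right (m := 1) (by norm_num)).clm_apply contDiff_const).differentiable
      (by norm_num)) x).hasFDerivAt
  have hgr : HasFDerivAt (gr f) _ x :=
    (hasFDerivAt_id (𝕜 := ℝ) x).fst.prodMk ((hasFDerivAt_id (𝕜 := ℝ) x).snd.prodMk hfx)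
  have hN : HasFDerivAt (Nf f) _ x :=
    (hpd 0).neg.prodMk ((hpd 1).neg.prodMk (hasFDerivAt_const (1 : ℝ) x))
  have hprod := fderiv_dot3_apply (hv.hasFDerivAt.comp x hgr) hN (e2 i)
  have htan : ((e2 i).1, (e2 i).2, fderiv ℝ f x (e2 i))
      = e3 i.castSucc + pd2 i f x • e3 2 := by
    fin_cases i <;> simp [e2, e3, pd2]
  have hchain : fderiv ℝ v (gr f x) ((e2 i).1, (e2 i).2, fderiv ℝ f x (e2 i))
      = pdv3 i.castSucc v (gr f x) + pd2 i f x • pdv3 2 v (gr f x) := by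
    rw [htan, map_add, map_smul]
    rfl
  have hsecond (j : Fin 2) : pd2 i (fun y => pd2 j f y) x = fderiv ℝ (pd2 j f) x (e2 i) := rfl
  rw [← hchain]
  refine hprod.trans ?_
  simp [dot3, c3, hsecond, Fin.sum_univ_two]
  ring

/-- Lemma 3.1 (rel-uh): for a C¹ vector field v near the graph of a C² function f,
((v·∇)v)̲·N_f − ((∂₃v)̲·N_f)(v̲·N_f)
  = v̲₁ ∂₁(v̲·N_f) + v̲₂ ∂₂(v̲·N_f) + Σ_{i,j=1,2} v̲ᵢ v̲ⱼ ∂ᵢ∂ⱼ f. -/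
theorem advective_trace_identity (f : P2 → ℝ) (hf : ContDiff ℝ 2 f)
    (U : Set P3) (hU : IsOpen U) (hgr : ∀ x : P2, gr f x ∈ U)
    (v : P3 → P3) (hv : ContDiffOn ℝ 1 v U) (x : P2) :
    dot3 (adv3 v v (gr f x)) (Nf f x)
        - dot3 (pdv3 2 v (gr f x)) (Nf f x) * dot3 (v (gr f x)) (Nf f x)
      = c3 0 (v (gr f x)) * pd2 0 (fun y => dot3 (v (gr f y)) (Nf f y)) x
        + c3 1 (v (gr f x)) * pd2 1 (fun y => dot3 (v (gr f y)) (Nf f y)) x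
        + ∑ i : Fin 2, ∑ j : Fin 2,
            c3 i.castSucc (v (gr f x)) * c3 j.castSucc (v (gr f x))
              * pd2 i (fun y => pd2 j f y) x := by
  have hvx : DifferentiableAt ℝ v (gr f x) :=
    (hv.differentiableOn (by norm_num)).differentiableAt (hU.mem_nhds (hgr x))
  rw [pd2_dot3_trace_Nf hf hvx, pd2_dot3_trace_Nf hf hvx]
  simp [adv3, dot3, c3, Nf, Fin.sum_univ_two, Fin.sum_univ_three]
  ring

end
end

section
/- Let f : ℝ² → ℝ be C² and let ĥ = (ĥ₁,ĥ₂,ĥ₃) be a C¹ vector field on an open subset U of ℝ³ containing the graph Γ_f, with ∇×ĥ = 0 on U and ĥ̲(x')·N_f(x') = 0 for all x' ∈ ℝ². Then for every x' ∈ ℝ²: Σ_{i,j=1,2} ĥ̲ᵢ(x') ĥ̲ⱼ(x') ∂ᵢ∂ⱼf(x') = (1/2) N_f(x') · (∇|ĥ|²)̲(x'), where |ĥ|² = ĥ₁² + ĥ₂² + ĥ₃². -/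
noncomputable section

/-- The gradient of a scalar function on ℝ³. -/
def grad3 (g : P3 → ℝ) (x : P3) : P3 := (pd3 0 g x, pd3 1 g x, pd3 2 g x)

/-- The curl ∇×v of a vector field on ℝ³. -/
def curl3 (v : P3 → P3) (x : P3) : P3 :=
  (pd3 1 (fun y => c3 2 (v y)) x - pd3 2 (fun y => c3 1 (v y)) x,
   pd3 2 (fun y => c3 0 (v y)) x - pd3 0 (fun y => c3 2 (v y)) x,
   pd3 0 (fun y => c3 1 (v y)) x - pd3 1 (fun y => c3 0 (v y)) x)

/-- A directional derivative of the tangency condition `h · N_f = 0` along the graph of `f`. -/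
theorem tangent_deriv {f : P2 → ℝ} (hf : ContDiff ℝ 2 f) {h : P3 → P3} {D : P3 →L[ℝ] P3}
    (x : P2) (hD : HasFDerivAt h D (gr f x))
    (htan : ∀ x : P2, dot3 (h (gr f x)) (Nf f x) = 0) (v : P2) :
    (D (v.1, v.2, fderiv ℝ f x v)).2.2 =
      (D (v.1, v.2, fderiv ℝ f x v)).1 * pd2 0 f x
      + (h (gr f x)).1 * fderiv ℝ (fun y => pd2 0 f y) x v
      + ((D (v.1, v.2, fderiv ℝ f x v)).2.1 * pd2 1 f x
      + (h (gr f x)).2.1 * fderiv ℝ (fun y => pd2 1 f y) x v) := by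
  have hfd : HasFDerivAt f (fderiv ℝ f x) x :=
    ((hf.differentiable (by norm_num)) x).hasFDerivAt
  have hpd (j : Fin 2) : HasFDerivAt (fun y => pd2 j f y) (fderiv ℝ (fun y => pd2 j f y) x) x := by
    have hdf : Differentiable ℝ (fderiv ℝ f) :=
      (hf.fderiv_right (m := 1) (by norm_num)).differentiable (by norm_num)
    exact (DifferentiableAt.clm_apply (hdf x) (differentiableAt_const (e2 j))).hasFDerivAt
  have hg : HasFDerivAt (gr f) ((ContinuousLinearMap.fst ℝ ℝ ℝ).prod
      ((ContinuousLinearMap.snd ℝ ℝ ℝ).prod (fderiv ℝ f x))) x :=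
    hasFDerivAt_fst.prodMk (hasFDerivAt_snd.prodMk hfd)
  have hc := hD.comp x hg
  have heq : (fun y => (h (gr f y)).2.2) =
      fun y => (h (gr f y)).1 * pd2 0 f y + (h (gr f y)).2.1 * pd2 1 f y := by
    funext y
    have := htan y
    simp only [dot3, Nf] at this
    linarith
  have hl : HasFDerivAt (fun y => (h (gr f y)).2.2) _ x := hc.snd.snd
  have hr : HasFDerivAt
      (fun y => (h (gr f y)).1 * pd2 0 f y + (h (gr f y)).2.1 * pd2 1 f y) _ x :=
    (hc.fst.mul (hpd 0)).add (hc.snd.fst.mul (hpd 1))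
  rw [heq] at hl
  have key := congrArg (fun L : P2 →L[ℝ] ℝ => L v) (hl.unique hr)
  simp at key
  linarith

/-- For a curl-free C¹ vector field ĥ tangent to the graph of a C² function f,
Σ_{i,j=1,2} ĥ̲ᵢ ĥ̲ⱼ ∂ᵢ∂ⱼ f = (1/2) N_f · (∇|ĥ|²)̲. -/
theorem curl_free_tangent_identity (f : P2 → ℝ) (hf : ContDiff ℝ 2 f)
    (U : Set P3) (hU : IsOpen U) (hgr : ∀ x : P2, gr f x ∈ U)
    (h : P3 → P3) (hh : ContDiffOn ℝ 1 h U)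
    (hcurl : ∀ y ∈ U, curl3 h y = (0 : P3))
    (htan : ∀ x : P2, dot3 (h (gr f x)) (Nf f x) = 0) (x : P2) :
    ∑ i : Fin 2, ∑ j : Fin 2,
        c3 i.castSucc (h (gr f x)) * c3 j.castSucc (h (gr f x))
          * pd2 i (fun y => pd2 j f y) x
      = (1 / 2) * dot3 (Nf f x) (grad3 (fun y => dot3 (h y) (h y)) (gr f x)) := by
  have hD : HasFDerivAt h (fderiv ℝ h (gr f x)) (gr f x) :=
    ((hh.differentiableOn (by norm_num)).differentiableAt (hU.mem_nhds (hgr x))).hasFDerivAt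
  have ht0 := tangent_deriv hf x hD htan (e2 0)
  have ht1 := tangent_deriv hf x hD htan (e2 1)
  have hc := hcurl _ (hgr x)
  have htx := htan x
  generalize fderiv ℝ h (gr f x) = D at hD ht0 ht1
  have hc0 : HasFDerivAt (fun y => (h y).1) _ (gr f x) := hD.fst
  have hc1 : HasFDerivAt (fun y => (h y).2.1) _ (gr f x) := hD.snd.fst
  have hc2 : HasFDerivAt (fun y => (h y).2.2) _ (gr f x) := hD.snd.snd
  have hsq : HasFDerivAt (fun y => dot3 (h y) (h y)) _ (gr f x) :=
    ((hc0.mul hc0).add (hc1.mul hc1)).add (hc2.mul hc2)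
  have hv0 : D (1, 0, pd2 0 f x) = D (1, 0, 0) + pd2 0 f x • D (0, 0, 1) := by
    rw [← map_smul, ← map_add]; simp
  have hv1 : D (0, 1, pd2 1 f x) = D (0, 1, 0) + pd2 1 f x • D (0, 0, 1) := by
    rw [← map_smul, ← map_add]; simp
  change (D (1, 0, pd2 0 f x)).2.2 = (D (1, 0, pd2 0 f x)).1 * pd2 0 f x
      + (h (gr f x)).1 * pd2 0 (fun y => pd2 0 f y) x
      + ((D (1, 0, pd2 0 f x)).2.1 * pd2 1 f x
      + (h (gr f x)).2.1 * pd2 0 (fun y => pd2 1 f y) x) at ht0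
  change (D (0, 1, pd2 1 f x)).2.2 = (D (0, 1, pd2 1 f x)).1 * pd2 0 f x
      + (h (gr f x)).1 * pd2 1 (fun y => pd2 0 f y) x
      + ((D (0, 1, pd2 1 f x)).2.1 * pd2 1 f x
      + (h (gr f x)).2.1 * pd2 1 (fun y => pd2 1 f y) x) at ht1
  rw [hv0] at ht0
  rw [hv1] at ht1
  simp [curl3, pd3, c3, e3, hc0.fderiv, hc1.fderiv, hc2.fderiv] at hc
  obtain ⟨hc12, hc20, hc01⟩ := hc
  simp only [dot3, Nf] at htx
  simp [Fin.sum_univ_two, c3]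
  simp only [dot3, grad3, pd3, Nf] at hsq ⊢
  rw [hsq.fderiv]
  simp [e3]
  simp at ht0 ht1
  generalize (D (1, 0, 0)).1 = a00 at *
  generalize (D (1, 0, 0)).2.1 = a01 at *
  generalize (D (1, 0, 0)).2.2 = a02 at *
  generalize (D (0, 1, 0)).1 = a10 at *
  generalize (D (0, 1, 0)).2.1 = a11 at *
  generalize (D (0, 1, 0)).2.2 = a12 at *
  generalize (D (0, 0, 1)).1 = a20 at *
  generalize (D (0, 0, 1)).2.1 = a21 at *
  generalize (D (0, 0, 1)).2.2 = a22 at *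
  have h3 : (h (gr f x)).2.2 = (h (gr f x)).1 * pd2 0 f x + (h (gr f x)).2.1 * pd2 1 f x := by
    linarith
  rw [h3]
  have e12 : a12 = a21 := by linarith
  have e20 : a20 = a02 := by linarith
  have e01 : a01 = a10 := by linarith
  subst e12 e20 e01
  linear_combination (-(h (gr f x)).1) * ht0 - (h (gr f x)).2.1 * ht1

end
end

section
/- Let I ⊆ ℝ be an open interval, f : I×ℝ² → ℝ be C², and let u, h : I×U → ℝ³ and p : I×U → ℝ be C¹, where U ⊆ ℝ³ is open and contains the moving graph {(x', f(t,x')) : x' ∈ ℝ²} for each t ∈ I. Assume that on I×U the momentum equation ∂_t u + (u·∇)u − (h·∇)h + ∇p = 0 holds, and that for all (t,x'): h̲(t,x')·N_f(t,x') = 0 and ∂_t f(t,x') = u̲(t,x')·N_f(t,x'). Set θ(t,x') = u̲(t,x')·N_f(t,x'). Then for all (t,x'): ∂_t θ = −2(u̲₁ ∂₁θ + u̲₂ ∂₂θ) − N_f · (∇p)̲ − Σ_{i,j=1,2} u̲ᵢ u̲ⱼ ∂ᵢ∂ⱼf + Σ_{i,j=1,2} h̲ᵢ h̲ⱼ ∂ᵢ∂ⱼf.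 -/
noncomputable section

/-- Cross product on ℝ³. -/
def cross3 (a b : P3) : P3 :=
  (a.2.1 * b.2.2 - a.2.2 * b.2.1, a.2.2 * b.1 - a.1 * b.2.2, a.1 * b.2.1 - a.2.1 * b.1)

/-- Time derivative ∂_t of a time-dependent vector field on ℝ×ℝ³. -/
def pdtv (v : ℝ × P3 → P3) (z : ℝ × P3) : P3 := fderiv ℝ v z (1, 0)

/-- Time derivative ∂_t of a time-dependent scalar function on ℝ×ℝ³. -/
def pdts (g : ℝ × P3 → ℝ) (z : ℝ × P3) : ℝ := fderiv ℝ g z (1, 0)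

/-- Spatial partial derivative ∂ᵢ of a time-dependent vector field on ℝ×ℝ³. -/
def spdv (i : Fin 3) (v : ℝ × P3 → P3) (z : ℝ × P3) : P3 := fderiv ℝ v z (0, e3 i)

/-- Spatial partial derivative ∂ᵢ of a time-dependent scalar function on ℝ×ℝ³. -/
def spd (i : Fin 3) (g : ℝ × P3 → ℝ) (z : ℝ × P3) : ℝ := fderiv ℝ g z (0, e3 i)

/-- The advective derivative (a·∇)v = Σ_k a_k ∂_k v (spatial derivatives only). -/
def advt (a v : ℝ × P3 → P3) (z : ℝ × P3) : P3 := ∑ i : Fin 3, c3 i (a z) • spdv i v z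

/-- The spatial gradient of a time-dependent scalar function. -/
def gradt (p : ℝ × P3 → ℝ) (z : ℝ × P3) : P3 := (spd 0 p z, spd 1 p z, spd 2 p z)

/-- The spatial divergence of a time-dependent vector field. -/
def divt (v : ℝ × P3 → P3) (z : ℝ × P3) : ℝ := ∑ i : Fin 3, spd i (fun w => c3 i (v w)) z

/-- The spatial curl ∇×v of a time-dependent vector field. -/
def curlt (v : ℝ × P3 → P3) (z : ℝ × P3) : P3 :=
  (spd 1 (fun w => c3 2 (v w)) z - spd 2 (fun w => c3 1 (v w)) z,
   spd 2 (fun w => c3 0 (v w)) z - spd 0 (fun w => c3 2 (v w)) z,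
   spd 0 (fun w => c3 1 (v w)) z - spd 1 (fun w => c3 0 (v w)) z)

/-- Spatial partial derivative ∂ᵢ of a time-dependent function on ℝ×ℝ². -/
def spd2 (i : Fin 2) (g : ℝ × P2 → ℝ) (z : ℝ × P2) : ℝ := fderiv ℝ g z (0, e2 i)

/-- Time derivative ∂_t of a time-dependent function on ℝ×ℝ². -/
def pdt2 (g : ℝ × P2 → ℝ) (z : ℝ × P2) : ℝ := fderiv ℝ g z (1, 0)

/-- The space-time point (t, x', f(t,x')) on the moving graph. -/
def grt (f : ℝ × P2 → ℝ) (t : ℝ) (x : P2) : ℝ × P3 := (t, (x.1, x.2, f (t, x)))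

/-- The (non-unit) normal N_f = (−∂₁f, −∂₂f, 1) of the moving graph. -/
def Nft (f : ℝ × P2 → ℝ) (t : ℝ) (x : P2) : P3 :=
  (-(spd2 0 f (t, x)), -(spd2 1 f (t, x)), 1)

/-- The scaled normal velocity θ = u̲·N_f on the moving interface. -/
def θtr (u : ℝ × P3 → P3) (f : ℝ × P2 → ℝ) (z : ℝ × P2) : ℝ :=
  dot3 (u (grt f z.1 z.2)) (Nft f z.1 z.2)

/-- Chain rule for the trace `v̲·N_f` of a vector field on the moving graph. -/
theorem fderiv_θtr_apply {f : ℝ × P2 → ℝ} {v : ℝ × P3 → P3} {z : ℝ × P2}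
    (hf : DifferentiableAt ℝ f z) (hf' : DifferentiableAt ℝ (fderiv ℝ f) z)
    (hv : DifferentiableAt ℝ v (grt f z.1 z.2)) (w : ℝ × P2) :
    fderiv ℝ (θtr v f) z w
      = dot3 (fderiv ℝ v (grt f z.1 z.2) (w.1, (w.2.1, w.2.2, fderiv ℝ f z w))) (Nft f z.1 z.2)
        - (v (grt f z.1 z.2)).1 * fderiv ℝ (fderiv ℝ f) z w (0, e2 0)
        - (v (grt f z.1 z.2)).2.1 * fderiv ℝ (fderiv ℝ f) z w (0, e2 1) := by
  have hγ : HasFDerivAt (fun z : ℝ × P2 => grt f z.1 z.2) _ z :=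
    hasFDerivAt_fst.prodMk
      (hasFDerivAt_snd.fst.prodMk (hasFDerivAt_snd.snd.prodMk hf.hasFDerivAt))
  have hvγ : HasFDerivAt (fun z : ℝ × P2 => v (grt f z.1 z.2)) _ z :=
    HasFDerivAt.comp z hv.hasFDerivAt hγ
  have hN (i : Fin 2) : HasFDerivAt (fun z => fderiv ℝ f z (0, e2 i)) _ z :=
    hf'.hasFDerivAt.clm_apply (hasFDerivAt_const _ z)
  have hθ : HasFDerivAt (θtr v f) _ z :=
    ((hvγ.fst.mul (hN 0).neg).add (hvγ.snd.fst.mul (hN 1).neg)).add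
      (hvγ.snd.snd.mul (hasFDerivAt_const (1 : ℝ) z))
  rw [hθ.fderiv]
  simp [dot3, Nft, spd2]
  ring

/-- Second-order partial derivatives through the derivative of `fderiv`. -/
theorem fderiv_fderiv_apply_const {f : ℝ × P2 → ℝ} {z : ℝ × P2}
    (hf' : DifferentiableAt ℝ (fderiv ℝ f) z) (a w : ℝ × P2) :
    fderiv ℝ (fun z => fderiv ℝ f z a) z w = fderiv ℝ (fderiv ℝ f) z w a := by
  rw [(hf'.hasFDerivAt.clm_apply (hasFDerivAt_const a z)).fderiv]
  simp

/-- Expansion of a linear map on space-time in the standard basis. -/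
theorem clm_apply_eq_basis (A : ℝ × P3 →L[ℝ] P3) (s a b c : ℝ) :
    A (s, (a, b, c)) = s • A (1, 0) + a • A (0, e3 0) + b • A (0, e3 1) + c • A (0, e3 2) := by
  simp only [← map_smul, ← map_add]
  simp [e3]

/-- Evolution equation of the scaled normal velocity θ = u̲·N_f:
∂_t θ = −2(u̲₁∂₁θ + u̲₂∂₂θ) − N_f·(∇p)̲ − Σ u̲ᵢu̲ⱼ∂ᵢ∂ⱼf + Σ h̲ᵢh̲ⱼ∂ᵢ∂ⱼf. -/
theorem scaled_normal_velocity_evolution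
    (I : Set ℝ) (hIo : IsOpen I) (hIc : I.OrdConnected)
    (U : Set P3) (hU : IsOpen U)
    (f : ℝ × P2 → ℝ) (hf : ContDiffOn ℝ 2 f (I ×ˢ (Set.univ : Set P2)))
    (u h : ℝ × P3 → P3) (p : ℝ × P3 → ℝ)
    (hu : ContDiffOn ℝ 1 u (I ×ˢ U)) (hh : ContDiffOn ℝ 1 h (I ×ˢ U))
    (hp : ContDiffOn ℝ 1 p (I ×ˢ U))
    (hgraph : ∀ t ∈ I, ∀ x : P2, ((x.1, x.2, f (t, x)) : P3) ∈ U)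
    (hmom : ∀ t ∈ I, ∀ y ∈ U,
      pdtv u (t, y) + advt u u (t, y) - advt h h (t, y) + gradt p (t, y) = 0)
    (htan : ∀ t ∈ I, ∀ x : P2, dot3 (h (grt f t x)) (Nft f t x) = 0)
    (hkin : ∀ t ∈ I, ∀ x : P2, pdt2 f (t, x) = dot3 (u (grt f t x)) (Nft f t x)) :
    ∀ t ∈ I, ∀ x : P2,
      pdt2 (θtr u f) (t, x)
        = -2 * (c3 0 (u (grt f t x)) * spd2 0 (θtr u f) (t, x)
                + c3 1 (u (grt f t x)) * spd2 1 (θtr u f) (t, x))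
          - dot3 (Nft f t x) (gradt p (grt f t x))
          - (∑ i : Fin 2, ∑ j : Fin 2,
              c3 i.castSucc (u (grt f t x)) * c3 j.castSucc (u (grt f t x))
                * spd2 i (fun z => spd2 j f z) (t, x))
          + (∑ i : Fin 2, ∑ j : Fin 2,
              c3 i.castSucc (h (grt f t x)) * c3 j.castSucc (h (grt f t x))
                * spd2 i (fun z => spd2 j f z) (t, x)) := by
  intro t ht x
  have hz : I ×ˢ (Set.univ : Set P2) ∈ nhds (t, x) :=
    (hIo.prod isOpen_univ).mem_nhds ⟨ht, trivial⟩
  have hgz : I ×ˢ U ∈ nhds (grt f t x) := (hIo.prod hU).mem_nhds ⟨ht, hgraph t ht x⟩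
  have hfz : ContDiffAt ℝ 2 f (t, x) := hf.contDiffAt hz
  have hfd : DifferentiableAt ℝ f (t, x) := hfz.differentiableAt (by norm_num)
  have hfd' : DifferentiableAt ℝ (fderiv ℝ f) (t, x) :=
    (hfz.fderiv_right (m := 1) (by norm_num)).differentiableAt (by norm_num)
  have hud : DifferentiableAt ℝ u (grt f t x) := (hu.contDiffAt hgz).differentiableAt (by norm_num)
  have hhd : DifferentiableAt ℝ h (grt f t x) := (hh.contDiffAt hgz).differentiableAt (by norm_num)
  have hsym (a b : ℝ × P2) : fderiv ℝ (fderiv ℝ f) (t, x) a b = fderiv ℝ (fderiv ℝ f) (t, x) b a :=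
    hfz.isSymmSndFDerivAt (by simp) a b
  have hθu := fderiv_θtr_apply hfd hfd' hud
  have hθh := fderiv_θtr_apply hfd hfd' hhd
  have hθt : fderiv ℝ (θtr u f) (t, x) = fderiv ℝ (fun z => fderiv ℝ f z (1, 0)) (t, x) := by
    refine Filter.EventuallyEq.fderiv_eq ?_
    filter_upwards [hz] with z hz'
    exact (hkin z.1 hz'.1 z.2).symm
  have hθ0 : fderiv ℝ (θtr h f) (t, x) = 0 := by
    have : θtr h f =ᶠ[nhds (t, x)] fun _ => (0 : ℝ) := by
      filter_upwards [hz] with z hz'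
      exact htan z.1 hz'.1 z.2
    rw [this.fderiv_eq]
    simp
  have hθt' (w : ℝ × P2) : fderiv ℝ (θtr u f) (t, x) w = fderiv ℝ (fderiv ℝ f) (t, x) (1, 0) w := by
    rw [hθt, fderiv_fderiv_apply_const hfd', hsym]
  have hk := hkin t ht x
  have hn := htan t ht x
  have hm := hmom t ht _ (hgraph t ht x)
  change pdtv u (grt f t x) + advt u u (grt f t x) - advt h h (grt f t x)
    + gradt p (grt f t x) = 0 at hm
  have hm1 := congrArg (fun a : P3 => a.1) hm
  have hm2 := congrArg (fun a : P3 => a.2.1) hm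
  have hm3 := congrArg (fun a : P3 => a.2.2) hm
  have ut := hθu (1, 0)
  have u0 := hθu (0, e2 0)
  have u1 := hθu (0, e2 1)
  have h0 := hθh (0, e2 0)
  have h1 := hθh (0, e2 1)
  rw [← hθt' (0, e2 0), ← hθt' (0, e2 1)] at ut
  rw [hθ0] at h0 h1
  simp only [clm_apply_eq_basis] at ut u0 u1 h0 h1
  simp only [Fin.sum_univ_two, pdt2, spd2, fderiv_fderiv_apply_const hfd']
  simp only [pdt2, spd2, dot3, Nft, advt, pdtv, spdv, gradt, Fin.sum_univ_three, c3, Prod.fst_add,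
    Prod.snd_add, Prod.fst_sub, Prod.snd_sub, Prod.smul_fst, Prod.smul_snd, smul_eq_mul,
    Matrix.cons_val_zero, Matrix.cons_val_one, Matrix.cons_val, Prod.fst_zero, Prod.snd_zero,
    Fin.castSucc_zero, Fin.castSucc_one, zero_apply]
    at ut u0 u1 h0 h1 hk hn hm1 hm2 hm3 ⊢
  have e00 : (e2 0).1 = 1 := rfl
  have e01 : (e2 0).2 = 0 := rfl
  have e10 : (e2 1).1 = 0 := rfl
  have e11 : (e2 1).2 = 1 := rfl
  simp only [e00, e01, e10, e11] at u0 u1 h0 h1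
  linear_combination ut + (u (grt f t x)).1 * u0 + (u (grt f t x)).2.1 * u1
    - (h (grt f t x)).1 * h0 - (h (grt f t x)).2.1 * h1
    - fderiv ℝ f (t, x) (0, e2 0) * hm1 - fderiv ℝ f (t, x) (0, e2 1) * hm2 + hm3
    + ((fderiv ℝ u (grt f t x) (0, e3 2)).2.2 - (fderiv ℝ u (grt f t x) (0, e3 2)).1 * fderiv ℝ f (t, x) (0, e2 0)
      - (fderiv ℝ u (grt f t x) (0, e3 2)).2.1 * fderiv ℝ f (t, x) (0, e2 1)) * hk
    + ((fderiv ℝ h (grt f t x) (0, e3 2)).2.2 - (fderiv ℝ h (grt f t x) (0, e3 2)).1 * fderiv ℝ f (t, x) (0, e2 0)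
      - (fderiv ℝ h (grt f t x) (0, e3 2)).2.1 * fderiv ℝ f (t, x) (0, e2 1)) * hn

end
end

section
/- Let I ⊆ ℝ be an open interval, U ⊆ ℝ³ open, and let u, h : I×U → ℝ³ and p : I×U → ℝ be C² and satisfy on I×U: ∂_t u + (u·∇)u − (h·∇)h + ∇p = 0, div u = 0, and div h = 0. Set ω = ∇×u and j = ∇×h (spatial curls). Then on I×U: ∂_t ω + (u·∇)ω − (h·∇)j = (ω·∇)u − (j·∇)h. -/
noncomputable section

/-- The second derivative of a scalar function in the directions `a`, then `b`. -/
def secondDeriv (f : ℝ × P3 → ℝ) (z a b : ℝ × P3) : ℝ := fderiv ℝ (fderiv ℝ f) z a b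

lemma secondDeriv_comm {f : ℝ × P3 → ℝ} {z : ℝ × P3} (hf : ContDiffAt ℝ 2 f z)
    (a b : ℝ × P3) : secondDeriv f z a b = secondDeriv f z b a :=
  hf.isSymmSndFDerivAt (by simp) a b

lemma differentiableAt_fderiv_apply {f : ℝ × P3 → ℝ} {z : ℝ × P3} (hf : ContDiffAt ℝ 2 f z)
    (b : ℝ × P3) : DifferentiableAt ℝ (fun w => fderiv ℝ f w b) z :=
  ((hf.fderiv_right (m := 1) (by norm_num)).differentiableAt (by simp)).clm_apply
    (differentiableAt_const b)

lemma fderiv_fderiv_apply {f : ℝ × P3 → ℝ} {z : ℝ × P3} (hf : ContDiffAt ℝ 2 f z)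
    (a b : ℝ × P3) : fderiv ℝ (fun w => fderiv ℝ f w b) z a = secondDeriv f z a b := by
  have hd : DifferentiableAt ℝ (fderiv ℝ f) z :=
    (hf.fderiv_right (m := 1) (by norm_num)).differentiableAt (by simp)
  rw [fderiv_clm_apply hd (differentiableAt_const b)]
  simp [secondDeriv]

lemma contDiff_c3 (i : Fin 3) : ContDiff ℝ 2 (c3 i) := by
  fin_cases i <;> simp only [c3] <;> dsimp <;> fun_prop

lemma c3_fderiv {v : ℝ × P3 → P3} {z : ℝ × P3} (hv : DifferentiableAt ℝ v z) (i : Fin 3)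
    (a : ℝ × P3) : c3 i (fderiv ℝ v z a) = fderiv ℝ (fun w => c3 i (v w)) z a := by
  fin_cases i
  · exact (congrArg (fun L => L a) hv.hasFDerivAt.fst.fderiv).symm
  · exact (congrArg (fun L => L a) hv.hasFDerivAt.snd.fst.fderiv).symm
  · exact (congrArg (fun L => L a) hv.hasFDerivAt.snd.snd.fderiv).symm

lemma c3_add (i : Fin 3) (a b : P3) : c3 i (a + b) = c3 i a + c3 i b := by
  fin_cases i <;> rfl

lemma c3_sub (i : Fin 3) (a b : P3) : c3 i (a - b) = c3 i a - c3 i b := by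
  fin_cases i <;> rfl

lemma c3_smul (i : Fin 3) (r : ℝ) (a : P3) : c3 i (r • a) = r * c3 i a := by
  fin_cases i <;> rfl

lemma c3_gradt (i : Fin 3) (p : ℝ × P3 → ℝ) (z : ℝ × P3) : c3 i (gradt p z) = spd i p z := by
  fin_cases i <;> rfl

lemma c3_ext {a b : P3} (hab : ∀ i, c3 i a = c3 i b) : a = b :=
  Prod.ext (hab 0) (Prod.ext (hab 1) (hab 2))

lemma c3_advt (i : Fin 3) (a : ℝ × P3 → P3) {v : ℝ × P3 → P3} {z : ℝ × P3}
    (hv : DifferentiableAt ℝ v z) :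
    c3 i (advt a v z) = ∑ k, c3 k (a z) * spd k (fun w => c3 i (v w)) z := by
  simp only [advt, Fin.sum_univ_three, c3_add, c3_smul, spdv, spd, c3_fderiv hv]

/-- Differentiability and derivative of a component of the advective derivative. -/
lemma fderiv_advection {a : ℝ × P3 → P3} {f : ℝ × P3 → ℝ} {z : ℝ × P3}
    (ha : ∀ k, DifferentiableAt ℝ (fun w => c3 k (a w)) z) (hf : ContDiffAt ℝ 2 f z)
    (d : ℝ × P3) :
    DifferentiableAt ℝ (fun w => ∑ k, c3 k (a w) * spd k f w) z ∧
    fderiv ℝ (fun w => ∑ k, c3 k (a w) * spd k f w) z d =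
      ∑ k, (c3 k (a z) * secondDeriv f z d (0, e3 k) +
        spd k f z * fderiv ℝ (fun w => c3 k (a w)) z d) := by
  have hs : ∀ k, DifferentiableAt ℝ (fun w => spd k f w) z := fun k =>
    differentiableAt_fderiv_apply hf _
  have hm : ∀ k ∈ Finset.univ, DifferentiableAt ℝ (fun w => c3 k (a w) * spd k f w) z :=
    fun k _ => (ha k).mul (hs k)
  refine ⟨DifferentiableAt.fun_sum hm, ?_⟩
  rw [fderiv_fun_sum hm, sum_apply]
  refine Finset.sum_congr rfl fun k _ => ?_
  rw [fderiv_fun_mul (ha k) (hs k)]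
  simp only [add_apply, smul_apply, smul_eq_mul]
  congr 2
  exact fderiv_fderiv_apply hf _ _

lemma contDiffAt_c3_comp {v : ℝ × P3 → P3} {z : ℝ × P3} (hv : ContDiffAt ℝ 2 v z) (i : Fin 3) :
    ContDiffAt ℝ 2 (fun w => c3 i (v w)) z :=
  (contDiff_c3 i).contDiffAt.comp z hv

/-- The momentum equation, component `i`, differentiated in the direction `d`. -/
lemma momentum_deriv {S : Set (ℝ × P3)} (hS : IsOpen S) {u h : ℝ × P3 → P3} {p : ℝ × P3 → ℝ}
    (hu : ContDiffOn ℝ 2 u S) (hh : ContDiffOn ℝ 2 h S) (hp : ContDiffOn ℝ 2 p S)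
    (hmom : ∀ z ∈ S, pdtv u z + advt u u z - advt h h z + gradt p z = 0)
    {z : ℝ × P3} (hz : z ∈ S) (i : Fin 3) (d : ℝ × P3) :
    secondDeriv (fun w => c3 i (u w)) z d (1, 0)
      + ∑ k, (c3 k (u z) * secondDeriv (fun w => c3 i (u w)) z d (0, e3 k) +
        spd k (fun w => c3 i (u w)) z * fderiv ℝ (fun w => c3 k (u w)) z d)
      - ∑ k, (c3 k (h z) * secondDeriv (fun w => c3 i (h w)) z d (0, e3 k) +
        spd k (fun w => c3 i (h w)) z * fderiv ℝ (fun w => c3 k (h w)) z d)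
      + secondDeriv p z d (0, e3 i) = 0 := by
  have hzero : (fun w => fderiv ℝ (fun w => c3 i (u w)) w (1, 0)
      + ∑ k, c3 k (u w) * spd k (fun w => c3 i (u w)) w
      - ∑ k, c3 k (h w) * spd k (fun w => c3 i (h w)) w
      + fderiv ℝ p w (0, e3 i)) =ᶠ[nhds z] fun _ => (0 : ℝ) := by
    filter_upwards [hS.mem_nhds hz] with w hw
    have hdu := (hu.contDiffAt (hS.mem_nhds hw)).differentiableAt (by simp)
    have hdh := (hh.contDiffAt (hS.mem_nhds hw)).differentiableAt (by simp)
    have hc := congrArg (c3 i) (hmom w hw)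
    rw [c3_add, c3_sub, c3_add, c3_advt i u hdu, c3_advt i h hdh, c3_gradt, pdtv,
      c3_fderiv hdu] at hc
    refine hc.trans ?_
    fin_cases i <;> rfl
  have hcu := contDiffAt_c3_comp (hu.contDiffAt (hS.mem_nhds hz))
  have hch := contDiffAt_c3_comp (hh.contDiffAt (hS.mem_nhds hz))
  have hcp := hp.contDiffAt (hS.mem_nhds hz)
  obtain ⟨hau, hau'⟩ := fderiv_advection
    (fun k => (hcu k).differentiableAt (by simp)) (hcu i) d
  obtain ⟨hah, hah'⟩ := fderiv_advection
    (fun k => (hch k).differentiableAt (by simp)) (hch i) d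
  have htu := differentiableAt_fderiv_apply (hcu i) (1, 0)
  have key := congrArg (fun L : ℝ × P3 →L[ℝ] ℝ => L d) hzero.fderiv_eq
  rw [fderiv_fun_add ((htu.fun_add hau).fun_sub hah) (differentiableAt_fderiv_apply hcp _),
    fderiv_fun_sub (htu.fun_add hau) hah, fderiv_fun_add htu hau] at key
  simp only [add_apply, sub_apply, hau', hah',
    fderiv_fderiv_apply (hcu i), fderiv_fderiv_apply hcp] at key
  simpa using key

/-- Differentiability and derivative of a difference of spatial partial derivatives. -/
lemma fderiv_spd_sub {f g : ℝ × P3 → ℝ} {z : ℝ × P3} (hf : ContDiffAt ℝ 2 f z)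
    (hg : ContDiffAt ℝ 2 g z) (i j : Fin 3) :
    DifferentiableAt ℝ (fun w => spd i f w - spd j g w) z ∧ ∀ d,
    fderiv ℝ (fun w => spd i f w - spd j g w) z d =
      secondDeriv f z d (0, e3 i) - secondDeriv g z d (0, e3 j) := by
  have h1 := differentiableAt_fderiv_apply hf (0, e3 i)
  have h2 := differentiableAt_fderiv_apply hg (0, e3 j)
  refine ⟨h1.fun_sub h2, fun d => ?_⟩
  simp only [spd]
  rw [fderiv_fun_sub h1 h2, sub_apply, fderiv_fderiv_apply hf,
    fderiv_fderiv_apply hg]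

lemma differentiableAt_curlt {v : ℝ × P3 → P3} {z : ℝ × P3} (hv : ContDiffAt ℝ 2 v z) :
    DifferentiableAt ℝ (curlt v) z :=
  have hc := contDiffAt_c3_comp hv
  (fderiv_spd_sub (hc 2) (hc 1) 1 2).1.prodMk
    ((fderiv_spd_sub (hc 0) (hc 2) 2 0).1.prodMk (fderiv_spd_sub (hc 1) (hc 0) 0 1).1)

lemma c3_curlt (i : Fin 3) (v : ℝ × P3 → P3) (z : ℝ × P3) :
    c3 i (curlt v z) = spd (i + 1) (fun w => c3 (i + 2) (v w)) z
      - spd (i + 2) (fun w => c3 (i + 1) (v w)) z := by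
  fin_cases i <;> rfl

/-- The vorticity equation for ideal incompressible MHD:
∂_t ω + (u·∇)ω − (h·∇)j = (ω·∇)u − (j·∇)h, where ω = ∇×u, j = ∇×h. -/
theorem vorticity_equation
    (I : Set ℝ) (hIo : IsOpen I) (hIc : I.OrdConnected)
    (U : Set P3) (hU : IsOpen U)
    (u h : ℝ × P3 → P3) (p : ℝ × P3 → ℝ)
    (hu : ContDiffOn ℝ 2 u (I ×ˢ U)) (hh : ContDiffOn ℝ 2 h (I ×ˢ U))
    (hp : ContDiffOn ℝ 2 p (I ×ˢ U))
    (hmom : ∀ t ∈ I, ∀ y ∈ U,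
      pdtv u (t, y) + advt u u (t, y) - advt h h (t, y) + gradt p (t, y) = 0)
    (hdivu : ∀ t ∈ I, ∀ y ∈ U, divt u (t, y) = 0)
    (hdivh : ∀ t ∈ I, ∀ y ∈ U, divt h (t, y) = 0) :
    ∀ t ∈ I, ∀ y ∈ U,
      pdtv (curlt u) (t, y) + advt u (curlt u) (t, y) - advt h (curlt h) (t, y)
        = advt (curlt u) u (t, y) - advt (curlt h) h (t, y) := by
  intro t ht y hy
  have hS : IsOpen (I ×ˢ U) := hIo.prod hU
  have hz : (t, y) ∈ I ×ˢ U := ⟨ht, hy⟩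
  have hmom' : ∀ z ∈ I ×ˢ U, pdtv u z + advt u u z - advt h h z + gradt p z = 0 :=
    fun z hz => hmom z.1 hz.1 z.2 hz.2
  have hDu := hdivu t ht y hy
  have hDh := hdivh t ht y hy
  have hM := momentum_deriv hS hu hh hp hmom' hz
  generalize (t, y) = z at *
  have hu2 := hu.contDiffAt (hS.mem_nhds hz)
  have hh2 := hh.contDiffAt (hS.mem_nhds hz)
  have hp2 := hp.contDiffAt (hS.mem_nhds hz)
  have hcu := contDiffAt_c3_comp hu2
  have hch := contDiffAt_c3_comp hh2
  have hdu := hu2.differentiableAt (by simp)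
  have hdh := hh2.differentiableAt (by simp)
  refine c3_ext fun i => ?_
  rw [c3_sub, c3_add, c3_sub, c3_advt i _ (differentiableAt_curlt hu2),
    c3_advt i _ (differentiableAt_curlt hh2), c3_advt i _ hdu, c3_advt i _ hdh, pdtv,
    c3_fderiv (differentiableAt_curlt hu2)]
  have hωu : ∀ d, fderiv ℝ (fun w => c3 i (curlt u w)) z d =
      secondDeriv (fun w => c3 (i + 2) (u w)) z (0, e3 (i + 1)) d
        - secondDeriv (fun w => c3 (i + 1) (u w)) z (0, e3 (i + 2)) d := fun d => by
    simp only [c3_curlt]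
    rw [(fderiv_spd_sub (hcu _) (hcu _) _ _).2, secondDeriv_comm (hcu _),
      secondDeriv_comm (hcu (i + 1))]
  have hωh : ∀ d, fderiv ℝ (fun w => c3 i (curlt h w)) z d =
      secondDeriv (fun w => c3 (i + 2) (h w)) z (0, e3 (i + 1)) d
        - secondDeriv (fun w => c3 (i + 1) (h w)) z (0, e3 (i + 2)) d := fun d => by
    simp only [c3_curlt]
    rw [(fderiv_spd_sub (hch _) (hch _) _ _).2, secondDeriv_comm (hch _),
      secondDeriv_comm (hch (i + 1))]
  have hM1 := hM (i + 2) (0, e3 (i + 1))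
  have hM2 := hM (i + 1) (0, e3 (i + 2))
  rw [secondDeriv_comm hp2] at hM1
  replace hDu : c3 i (curlt u z) * divt u z = 0 := by rw [hDu, mul_zero]
  replace hDh : c3 i (curlt h z) * divt h z = 0 := by rw [hDh, mul_zero]
  simp only [divt, spd, hωu, hωh, Fin.sum_univ_three] at hM1 hM2 hDu hDh ⊢
  simp only [c3_curlt, spd] at hDu hDh ⊢
  fin_cases i <;> simp only [Fin.zero_eta, Fin.mk_one, Fin.reduceFinMk, zero_add, Fin.reduceAdd,
    Fin.isValue] at hM1 hM2 hDu hDh ⊢ <;>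
  linear_combination hM1 - hM2 - hDu + hDh

end
end

section
/- Let I ⊆ ℝ be an open interval, f : I×ℝ² → ℝ be C², and let u, h : I×U → ℝ³ be C¹, where U ⊆ ℝ³ is open and contains the moving graph {(x', f(t,x')) : x' ∈ ℝ²} for each t ∈ I. Assume that for all (t,x') ∈ I×ℝ²: ∂_t f(t,x') = u̲(t,x')·N_f(t,x') and h̲(t,x')·N_f(t,x') = 0. Then for all (t,x') ∈ I×ℝ²: (∂_t h + (u·∇)h − (h·∇)u)̲(t,x') · N_f(t,x') = 0. -/
noncomputable section

lemma dot3_Nft (f : ℝ × P2 → ℝ) (t : ℝ) (x : P2) (a : P3) :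
    dot3 a (Nft f t x) = a.2.2 - fderiv ℝ f (t, x) (0, (a.1, a.2.1)) := by
  have h : ((0, (a.1, a.2.1)) : ℝ × P2)
      = a.1 • ((0, (1, 0)) : ℝ × P2) + a.2.1 • ((0, (0, 1)) : ℝ × P2) := by simp
  rw [h, map_add, map_smul, map_smul]
  simp [dot3, Nft, spd2, e2]
  ring

lemma advt_eq_fderiv (a v : ℝ × P3 → P3) (z : ℝ × P3) :
    advt a v z = fderiv ℝ v z (0, a z) := by
  have h : ((0, a z) : ℝ × P3) = ∑ i : Fin 3, c3 i (a z) • ((0, e3 i) : ℝ × P3) := by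
    simp [Fin.sum_univ_three, c3, e3]
  rw [h, map_sum]
  simp only [map_smul]
  rfl

lemma hasFDerivAt_grt {f : ℝ × P2 → ℝ} {f' : ℝ × P2 →L[ℝ] ℝ} {z : ℝ × P2}
    (hf : HasFDerivAt f f' z) :
    ∃ L : ℝ × P2 →L[ℝ] ℝ × P3, HasFDerivAt (fun y : ℝ × P2 => grt f y.1 y.2) L z ∧
      ∀ w, L w = (w.1, (w.2.1, w.2.2, f' w)) := by
  have h1 : HasFDerivAt (fun y : ℝ × P2 => y.1) (ContinuousLinearMap.fst ℝ ℝ P2) z := hasFDerivAt_fst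
  have h2 : HasFDerivAt (fun y : ℝ × P2 => y.2) (ContinuousLinearMap.snd ℝ ℝ P2) z :=
    hasFDerivAt_snd
  exact ⟨_, h1.prodMk (h2.fst.prodMk (h2.snd.prodMk hf)), fun w => rfl⟩

/-- Differentiating the identity `Df (c, a₁, a₂) = a₃` along a vector `w`. -/
lemma fderiv_fderiv_add_of_eventually_eq {f : ℝ × P2 → ℝ} {z : ℝ × P2}
    (hf : DifferentiableAt ℝ (fderiv ℝ f) z) {a : ℝ × P2 → P3} {a' : ℝ × P2 →L[ℝ] P3}
    (ha : HasFDerivAt a a' z) (c : ℝ)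
    (hE : ∀ᶠ y in nhds z, fderiv ℝ f y (c, ((a y).1, (a y).2.1)) = (a y).2.2) (w : ℝ × P2) :
    fderiv ℝ (fderiv ℝ f) z w (c, ((a z).1, (a z).2.1))
      + fderiv ℝ f z (0, ((a' w).1, (a' w).2.1)) = (a' w).2.2 := by
  have hV := (hasFDerivAt_const c z).prodMk (ha.fst.prodMk ha.snd.fst)
  have hL := (hf.hasFDerivAt.clm_apply hV).congr_of_eventuallyEq
    (Filter.EventuallyEq.symm hE)
  have := DFunLike.congr_fun (hL.unique ha.snd.snd) w
  simp at this
  rw [add_comm]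
  exact this

/-- If the interface moves with the fluid and h is tangent to the moving graph, then
(∂_t h + (u·∇)h − (h·∇)u)̲ · N_f = 0 on the moving graph. -/
theorem induction_tangency
    (I : Set ℝ) (hIo : IsOpen I) (hIc : I.OrdConnected)
    (U : Set P3) (hU : IsOpen U)
    (f : ℝ × P2 → ℝ) (hf : ContDiffOn ℝ 2 f (I ×ˢ (Set.univ : Set P2)))
    (u h : ℝ × P3 → P3)
    (hu : ContDiffOn ℝ 1 u (I ×ˢ U)) (hh : ContDiffOn ℝ 1 h (I ×ˢ U))
    (hgraph : ∀ t ∈ I, ∀ x : P2, ((x.1, x.2, f (t, x)) : P3) ∈ U)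
    (hkin : ∀ t ∈ I, ∀ x : P2, pdt2 f (t, x) = dot3 (u (grt f t x)) (Nft f t x))
    (htan : ∀ t ∈ I, ∀ x : P2, dot3 (h (grt f t x)) (Nft f t x) = 0) :
    ∀ t ∈ I, ∀ x : P2,
      dot3 (pdtv h (grt f t x) + advt u h (grt f t x) - advt h u (grt f t x))
        (Nft f t x) = 0 := by
  intro t ht x
  have hS : IsOpen (I ×ˢ (Set.univ : Set P2)) := hIo.prod isOpen_univ
  have hz : I ×ˢ (Set.univ : Set P2) ∈ nhds (t, x) := hS.mem_nhds ⟨ht, trivial⟩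
  have hIU : I ×ˢ U ∈ nhds (grt f t x) := (hIo.prod hU).mem_nhds ⟨ht, hgraph t ht x⟩
  have hfz : ContDiffAt ℝ 2 f (t, x) := hf.contDiffAt hz
  have hf2 : DifferentiableAt ℝ (fderiv ℝ f) (t, x) :=
    (hfz.fderiv_right (m := 1) (by norm_num)).differentiableAt (by norm_num)
  have hsymm : IsSymmSndFDerivAt ℝ f (t, x) := hfz.isSymmSndFDerivAt (by simp)
  obtain ⟨G', hG, hG'⟩ := hasFDerivAt_grt (hfz.differentiableAt (by norm_num)).hasFDerivAt
  have hu' := ((hu.contDiffAt hIU).differentiableAt (by norm_num)).hasFDerivAt.comp (t, x) hG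
  have hh' := ((hh.contDiffAt hIU).differentiableAt (by norm_num)).hasFDerivAt.comp (t, x) hG
  have hA : ∀ y ∈ I ×ˢ (Set.univ : Set P2), fderiv ℝ f y
      (1, ((u (grt f y.1 y.2)).1, (u (grt f y.1 y.2)).2.1)) = (u (grt f y.1 y.2)).2.2 := by
    rintro ⟨s, y⟩ ⟨hs, -⟩
    have hk := hkin s hs y
    rw [dot3_Nft, pdt2] at hk
    have hsplit : ∀ p : P2, ((1, p) : ℝ × P2) = (1, 0) + (0, p) := by simp
    rw [hsplit, map_add, hk]
    simp
  have hB : ∀ y ∈ I ×ˢ (Set.univ : Set P2), fderiv ℝ f y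
      (0, ((h (grt f y.1 y.2)).1, (h (grt f y.1 y.2)).2.1)) = (h (grt f y.1 y.2)).2.2 := by
    rintro ⟨s, y⟩ ⟨hs, -⟩
    have hk := htan s hs y
    rw [dot3_Nft] at hk
    exact (sub_eq_zero.mp hk).symm
  set g := grt f t x with hg
  have hAz := hA (t, x) ⟨ht, trivial⟩
  have hBz := hB (t, x) ⟨ht, trivial⟩
  have hDu := fderiv_fderiv_add_of_eventually_eq hf2 hu' 1 (Filter.eventually_of_mem hz hA)
    (0, ((h g).1, (h g).2.1))
  have hDh := fderiv_fderiv_add_of_eventually_eq hf2 hh' 0 (Filter.eventually_of_mem hz hB)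
    (1, ((u g).1, (u g).2.1))
  simp only [ContinuousLinearMap.comp_apply, Function.comp_apply, hG', ← hg] at hDu hDh hAz hBz
  rw [hBz] at hDu
  rw [hAz] at hDh
  rw [hsymm.eq] at hDu
  have hmat : pdtv h g + advt u h g = fderiv ℝ h g (1, u g) := by
    rw [advt_eq_fderiv, pdtv, ← map_add]
    simp
  rw [hmat, advt_eq_fderiv, dot3_Nft]
  set p := fderiv ℝ h g (1, u g) with hp
  set q := fderiv ℝ u g (0, h g) with hq
  have hsub : ((0, ((p - q).1, (p - q).2.1)) : ℝ × P2)
      = (0, (p.1, p.2.1)) - (0, (q.1, q.2.1)) := by simp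
  rw [hsub, map_sub]
  change _ + fderiv ℝ f (t, x) (0, (q.1, q.2.1)) = q.2.2 at hDu
  change _ + fderiv ℝ f (t, x) (0, (p.1, p.2.1)) = p.2.2 at hDh
  simp only [Prod.snd_sub]
  linarith

end
end

section
/- Let s ≥ 3 be an integer and c₁, L₀ > 0. Let a, b, b̂ : 𝕋² → ℝ² be continuous with ‖a‖_{L∞}, ‖b‖_{L∞}, ‖b̂‖_{L∞} ≤ L₀ and such that for every x ∈ 𝕋² and every ξ ∈ ℝ²: (b(x)·ξ)² + (b̂(x)·ξ)² ≥ c₁|ξ|². Then there exists a constant C > 0 depending only on s, c₁, L₀ such that for all smooth f, θ : 𝕋² → ℝ, writing G = ⟨∇⟩^{s−1/2} f, one has ‖f‖²_{H^{s+1/2}} + ‖θ‖²_{H^{s−1/2}} ≤ C ( ‖⟨∇⟩^{s−1/2}θ + a₁∂₁G + a₂∂₂G‖²_{L²} + (1/2)‖b₁∂₁G + b₂∂₂G‖²_{L²} + (1/2)‖b̂₁∂₁G + b̂₂∂₂G‖²_{L²} + ‖θ‖²_{L²} + ‖f‖²_{L²} ). -/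
noncomputable section

open MeasureTheory

/-- The fundamental periodicity cell [0,2π]² in ℝ². -/
def Q2 : Set P2 := Set.Icc (0 : ℝ) (2 * Real.pi) ×ˢ Set.Icc (0 : ℝ) (2 * Real.pi)

/-- A function on ℝ² is 2π-periodic in each variable (i.e., lives on 𝕋²). -/
def Per2 {α : Type} (g : P2 → α) : Prop :=
  (∀ x : P2, g (x.1 + 2 * Real.pi, x.2) = g x) ∧
  (∀ x : P2, g (x.1, x.2 + 2 * Real.pi) = g x)

/-- The k-th Fourier coefficient ĝ(k) = (2π)⁻² ∫_{[0,2π]²} g(x) e^{−ik·x} dx. -/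
def fc (g : P2 → ℝ) (k : ℤ × ℤ) : ℂ :=
  (1 / (2 * Real.pi) ^ 2 : ℂ) *
    ∫ x in Q2, (g x : ℂ) *
      Complex.exp (-Complex.I * ((k.1 : ℂ) * (x.1 : ℂ) + (k.2 : ℂ) * (x.2 : ℂ)))

/-- The weight 1 + |k|² for k ∈ ℤ². -/
def wt (k : ℤ × ℤ) : ℝ := 1 + (k.1 : ℝ) ^ 2 + (k.2 : ℝ) ^ 2

/-- The squared Sobolev norm ‖g‖²_{H^σ} = Σ_k (1+|k|²)^σ |ĝ(k)|². -/
def HSq (σ : ℝ) (g : P2 → ℝ) : ℝ := ∑' k : ℤ × ℤ, wt k ^ σ * ‖fc g k‖ ^ 2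

/-- The squared L² norm ‖g‖²_{L²} = Σ_k |ĝ(k)|². -/
def L2Sq (g : P2 → ℝ) : ℝ := ∑' k : ℤ × ℤ, ‖fc g k‖ ^ 2

/-- The operator ⟨∇⟩^σ, defined via (⟨∇⟩^σ g)^∧(k) = (1+|k|²)^{σ/2} ĝ(k). -/
def Jop (σ : ℝ) (g : P2 → ℝ) (x : P2) : ℝ :=
  (∑' k : ℤ × ℤ, ((wt k ^ (σ / 2) : ℝ) : ℂ) * fc g k *
      Complex.exp (Complex.I * ((k.1 : ℂ) * (x.1 : ℂ) + (k.2 : ℂ) * (x.2 : ℂ)))).re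

/-- Components of a vector in ℝ². -/
def c2 : Fin 2 → P2 → ℝ := ![fun p => p.1, fun p => p.2]

/-- Euclidean dot product on ℝ². -/
def dot2 (a b : P2) : ℝ := a.1 * b.1 + a.2 * b.2


/-- The probability Haar measure on `ℝ / ℤ`, the normalization used for `UnitAddTorus`. -/
local instance : MeasureSpace UnitAddCircle := ⟨AddCircle.haarAddCircle⟩

local instance : IsProbabilityMeasure (volume : Measure UnitAddCircle) :=
  inferInstanceAs (IsProbabilityMeasure AddCircle.haarAddCircle)

/-- The coordinates in `(0, 2π]²` of a point of the unit torus. -/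
def torusCoord (t : UnitAddTorus (Fin 2)) : P2 :=
  (2 * Real.pi * (AddCircle.equivIoc 1 0 (t 0)).1, 2 * Real.pi * (AddCircle.equivIoc 1 0 (t 1)).1)

lemma measurable_torusCoord : Measurable torusCoord := by
  have h : Measurable (fun u : UnitAddCircle => 2 * Real.pi * (AddCircle.equivIoc 1 0 u).1) :=
    (measurable_subtype_coe.comp (AddCircle.measurableEquivIoc (1 : ℝ) 0).measurable).const_mul _
  exact (h.comp (measurable_pi_apply 0)).prodMk (h.comp (measurable_pi_apply 1))

lemma torusCoord_mem (t : UnitAddTorus (Fin 2)) : torusCoord t ∈ Q2 := by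
  have h : ∀ u : UnitAddCircle, 2 * Real.pi * (AddCircle.equivIoc (1 : ℝ) 0 u).1 ∈
      Set.Icc (0 : ℝ) (2 * Real.pi) := fun u => by
    have h1 := (AddCircle.equivIoc (1 : ℝ) 0 u).2
    have := Real.pi_pos
    have h2 := h1.1
    have h3 := h1.2.trans_eq (zero_add 1)
    exact ⟨by nlinarith, by nlinarith⟩
  exact ⟨h (t 0), h (t 1)⟩

open scoped Pointwise in
lemma smul_unitSquare :
    (2 * Real.pi) • (Set.Ioc (0 : ℝ) 1 ×ˢ Set.Ioc (0 : ℝ) 1) =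
      Set.Ioc (0 : ℝ) (2 * Real.pi) ×ˢ Set.Ioc (0 : ℝ) (2 * Real.pi) := by
  have hp := Real.two_pi_pos
  ext x
  rw [Set.mem_smul_set_iff_inv_smul_mem₀ hp.ne']
  have h : ∀ y : ℝ, (2 * Real.pi)⁻¹ * y ∈ Set.Ioc (0 : ℝ) 1 ↔ y ∈ Set.Ioc 0 (2 * Real.pi) := by
    intro y
    rw [Set.mem_Ioc, Set.mem_Ioc, inv_mul_le_one₀ hp]
    exact and_congr_left fun _ => by rw [mul_pos_iff_of_pos_left (inv_pos.mpr hp)]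
  exact and_congr (h x.1) (h x.2)

lemma Q2_ae_eq : Q2 =ᵐ[volume]
    (Set.Ioc (0 : ℝ) (2 * Real.pi) ×ˢ Set.Ioc (0 : ℝ) (2 * Real.pi) : Set P2) :=
  Measure.set_prod_ae_eq Ioc_ae_eq_Icc.symm Ioc_ae_eq_Icc.symm

open scoped Pointwise in
lemma integral_torusCoord {E : Type*} [NormedAddCommGroup E] [NormedSpace ℝ E] (H : P2 → E) :
    ∫ t : UnitAddTorus (Fin 2), H (torusCoord t) =
      ((2 * Real.pi) ^ 2)⁻¹ • ∫ x in Q2, H x := by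
  have hp := Real.two_pi_pos
  have hfin : Module.finrank ℝ P2 = 2 := by simp
  have hscale := Measure.setIntegral_comp_smul_of_pos (volume : Measure P2) H
    (Set.Ioc (0 : ℝ) 1 ×ˢ Set.Ioc (0 : ℝ) 1) hp
  rw [hfin] at hscale
  rw [setIntegral_congr_set Q2_ae_eq, ← smul_unitSquare, ← hscale,
    UnitAddTorus.integral_preimage _ 0,
    ← (volume_preserving_finTwoArrow ℝ).setIntegral_preimage_emb
      (MeasurableEquiv.measurableEmbedding _)]
  have hs : {x : Fin 2 → ℝ | ∀ i, x i ∈ Set.Ioc ((0 : Fin 2 → ℝ) i) ((0 : Fin 2 → ℝ) i + 1)} =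
      MeasurableEquiv.finTwoArrow ⁻¹' (Set.Ioc (0 : ℝ) 1 ×ˢ Set.Ioc (0 : ℝ) 1) := by
    ext x
    simp [Fin.forall_fin_two, MeasurableEquiv.finTwoArrow]
  rw [hs]
  refine setIntegral_congr_fun ?_ ?_
  · exact (MeasurableEquiv.measurable _) (measurableSet_Ioc.prod measurableSet_Ioc)
  · intro x hx
    have h0 : x 0 ∈ Set.Ioc (0 : ℝ) (0 + 1) := by simpa using hx.1
    have h1 : x 1 ∈ Set.Ioc (0 : ℝ) (0 + 1) := by simpa using hx.2
    simp only [torusCoord]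
    rw [AddCircle.equivIoc_coe_eq h0, AddCircle.equivIoc_coe_eq h1]
    rfl

/-- The character `x ↦ exp (i k·x)` of the torus. -/
def ef (k : ℤ × ℤ) (x : P2) : ℂ :=
  Complex.exp (Complex.I * ((k.1 : ℂ) * (x.1 : ℂ) + (k.2 : ℂ) * (x.2 : ℂ)))

lemma fc_eq (g : P2 → ℝ) (k : ℤ × ℤ) :
    fc g k = ((2 * Real.pi) ^ 2 : ℂ)⁻¹ * ∫ x in Q2, (g x : ℂ) * ef (-k) x := by
  unfold fc ef
  rw [one_div]
  congr 2
  ext x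
  congr 2
  simp
  ring

lemma mFourier_eq_ef (n : Fin 2 → ℤ) (t : UnitAddTorus (Fin 2)) :
    UnitAddTorus.mFourier n t = ef (n 0, n 1) (torusCoord t) := by
  have h : ∀ (m : ℤ) (u : UnitAddCircle), fourier m u =
      Complex.exp (2 * Real.pi * Complex.I * m * (AddCircle.equivIoc (1 : ℝ) 0 u).1) := by
    intro m u
    have : u = ((AddCircle.equivIoc (1 : ℝ) 0 u).1 : UnitAddCircle) :=
      ((AddCircle.equivIoc (1 : ℝ) 0).symm_apply_apply u).symm
    conv_lhs => rw [this]
    rw [fourier_coe_apply]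
    simp
  simp only [UnitAddTorus.mFourier, ContinuousMap.coe_mk, Fin.prod_univ_two, h, ef, torusCoord]
  rw [← Complex.exp_add]
  congr 1
  simp
  ring

lemma mFourierCoeff_torusCoord (g : P2 → ℝ) (n : Fin 2 → ℤ) :
    UnitAddTorus.mFourierCoeff (fun t => (g (torusCoord t) : ℂ)) n = fc g (n 0, n 1) := by
  rw [fc_eq, UnitAddTorus.mFourierCoeff]
  simp only [mFourier_eq_ef]
  have := integral_torusCoord (fun x => (g x : ℂ) * ef (-(n 0, n 1)) x)
  simp only [smul_eq_mul, mul_comm (ef _ _)]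
  refine this.trans ?_
  rw [Complex.real_smul]
  push_cast
  rfl

lemma isCompact_Q2 : IsCompact Q2 := isCompact_Icc.prod isCompact_Icc

lemma exists_bound_Q2 {E : Type*} [NormedAddCommGroup E] {g : P2 → E} (hg : Continuous g) :
    ∃ M, ∀ x ∈ Q2, ‖g x‖ ≤ M :=
  isCompact_Q2.exists_bound_of_continuousOn hg.continuousOn

/-- Parseval's identity on the square torus. -/
lemma hasSum_norm_fc_sq {g : P2 → ℝ} (hg : Continuous g) :
    HasSum (fun k => ‖fc g k‖ ^ 2) (((2 * Real.pi) ^ 2)⁻¹ * ∫ x in Q2, g x ^ 2) := by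
  obtain ⟨M, hM⟩ := exists_bound_Q2 hg
  have hmem : MemLp (fun t => (g (torusCoord t) : ℂ)) 2
      (volume : Measure (UnitAddTorus (Fin 2))) := by
    refine MemLp.of_bound (C := M) ?_ (.of_forall fun t => ?_)
    · exact (Complex.measurable_ofReal.comp
        (hg.measurable.comp measurable_torusCoord)).aestronglyMeasurable
    · simpa using hM _ (torusCoord_mem t)
  have h := UnitAddTorus.hasSum_sq_mFourierCoeff (hmem.toLp _)
  have hc : ∀ n, UnitAddTorus.mFourierCoeff (hmem.toLp _) n = fc g (n 0, n 1) := by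
    intro n
    rw [← mFourierCoeff_torusCoord]
    refine integral_congr_ae ?_
    filter_upwards [hmem.coeFn_toLp] with t ht
    rw [ht]
  have hi : ∫ t, ‖hmem.toLp _ t‖ ^ 2 = ((2 * Real.pi) ^ 2)⁻¹ * ∫ x in Q2, g x ^ 2 := by
    rw [← smul_eq_mul, ← integral_torusCoord (fun x => g x ^ 2)]
    refine integral_congr_ae ?_
    filter_upwards [hmem.coeFn_toLp] with t ht
    rw [ht]
    simp
  simp only [hc] at h
  rw [hi] at h
  exact ((finTwoArrowEquiv ℤ).hasSum_iff (f := fun k => ‖fc g k‖ ^ 2)).mp h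

lemma L2Sq_eq {g : P2 → ℝ} (hg : Continuous g) :
    L2Sq g = ((2 * Real.pi) ^ 2)⁻¹ * ∫ x in Q2, g x ^ 2 :=
  (hasSum_norm_fc_sq hg).tsum_eq

/-- The phase `x ↦ i k·x` as a continuous linear map. -/
def phase (k : ℤ × ℤ) : P2 →L[ℝ] ℂ :=
  (Complex.I * k.1) • Complex.ofRealCLM.comp (ContinuousLinearMap.fst ℝ ℝ ℝ) +
    (Complex.I * k.2) • Complex.ofRealCLM.comp (ContinuousLinearMap.snd ℝ ℝ ℝ)

/-- The components of a frequency `k ∈ ℤ²`. -/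
def freq (k : ℤ × ℤ) : Fin 2 → ℤ := ![k.1, k.2]

lemma phase_apply (k : ℤ × ℤ) (x : P2) :
    phase k x = Complex.I * ((k.1 : ℂ) * (x.1 : ℂ) + (k.2 : ℂ) * (x.2 : ℂ)) := by
  simp [phase]
  ring

lemma phase_e2 (k : ℤ × ℤ) (i : Fin 2) : phase k (e2 i) = Complex.I * freq k i := by
  rw [phase_apply]
  fin_cases i <;> simp [e2, freq]

lemma ef_eq_exp_phase (k : ℤ × ℤ) : ef k = fun x => Complex.exp (phase k x) := by
  ext x
  rw [phase_apply, ef]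

lemma contDiff_ef {n : WithTop ℕ∞} (k : ℤ × ℤ) : ContDiff ℝ n (ef k) := by
  rw [ef_eq_exp_phase]
  exact (phase k).contDiff.cexp

lemma continuous_ef (k : ℤ × ℤ) : Continuous (ef k) :=
  (contDiff_ef (n := 0) k).continuous

lemma hasFDerivAt_ef (k : ℤ × ℤ) (x : P2) : HasFDerivAt (ef k) (ef k x • phase k) x := by
  rw [ef_eq_exp_phase]
  exact (phase k).hasFDerivAt.cexp

lemma norm_ef (k : ℤ × ℤ) (x : P2) : ‖ef k x‖ = 1 := by
  rw [ef, mul_comm]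
  exact_mod_cast Complex.norm_exp_ofReal_mul_I ((k.1 : ℝ) * x.1 + (k.2 : ℝ) * x.2)

lemma ef_add (j k : ℤ × ℤ) (x : P2) : ef (j + k) x = ef j x * ef k x := by
  simp only [ef, ← Complex.exp_add]
  congr 1
  simp
  ring

lemma ef_zero (x : P2) : ef 0 x = 1 := by
  simp [ef]

lemma ef_neg (k : ℤ × ℤ) (x : P2) : ef (-k) x = (starRingEnd ℂ) (ef k x) := by
  simp only [ef, ← Complex.exp_conj]
  congr 1
  simp
  ring

lemma per2_ef (k : ℤ × ℤ) : Per2 (ef k) := by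
  constructor <;> intro x <;> simp only [ef] <;> rw [Complex.exp_eq_exp_iff_exists_int]
  · exact ⟨k.1, by push_cast; ring⟩
  · exact ⟨k.2, by push_cast; ring⟩

lemma integrableOn_Q2 {E : Type*} [NormedAddCommGroup E] {g : P2 → E} (hg : Continuous g) :
    IntegrableOn g Q2 :=
  hg.continuousOn.integrableOn_compact isCompact_Q2

lemma integral_fderiv_e2_eq_zero {h : P2 → ℂ} (hh : ContDiff ℝ 1 h) (hper : Per2 h) (i : Fin 2) :
    ∫ x in Q2, fderiv ℝ h x (e2 i) = 0 := by
  have hp := Real.two_pi_pos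
  have hQ : Q2 = Set.Icc ((0, 0) : P2) (2 * Real.pi, 2 * Real.pi) := Set.Icc_prod_Icc _ _ _ _
  have hd : ∀ x, HasFDerivAt h (fderiv ℝ h x) x := fun x =>
    (hh.differentiable one_ne_zero x).hasFDerivAt
  have hc : Continuous fun x => fderiv ℝ h x (e2 i) :=
    (hh.continuous_fderiv one_ne_zero).clm_apply continuous_const
  have hle : ((0, 0) : P2) ≤ (2 * Real.pi, 2 * Real.pi) := ⟨hp.le, hp.le⟩
  have hi := integrableOn_Q2 hc
  rw [hQ] at hi ⊢
  have p1 : ∀ y, h (2 * Real.pi, y) = h (0, y) := fun y => by simpa using hper.1 (0, y)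
  have p2 : ∀ y, h (y, 2 * Real.pi) = h (y, 0) := fun y => by simpa using hper.2 (y, 0)
  fin_cases i
  · have := integral_divergence_prod_Icc_of_hasFDerivAt_of_le h (fun _ => 0) (fderiv ℝ h)
      (fun _ => 0) _ _ hle hh.continuous.continuousOn continuousOn_const (fun x _ => hd x)
      (fun x _ => hasFDerivAt_const _ _) (by simpa [e2] using hi)
    simpa [e2, p1] using this
  · have := integral_divergence_prod_Icc_of_hasFDerivAt_of_le (fun _ => 0) h (fun _ => 0)
      (fderiv ℝ h) _ _ hle continuousOn_const hh.continuous.continuousOn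
      (fun x _ => hasFDerivAt_const _ _) (fun x _ => hd x) (by simpa [e2] using hi)
    simpa [e2, p2] using this

lemma Per2.mul {g h : P2 → ℂ} (hg : Per2 g) (hh : Per2 h) : Per2 fun x => g x * h x :=
  ⟨fun x => congrArg₂ _ (hg.1 x) (hh.1 x), fun x => congrArg₂ _ (hg.2 x) (hh.2 x)⟩

lemma Per2.ofReal {g : P2 → ℝ} (hg : Per2 g) : Per2 fun x => (g x : ℂ) :=
  ⟨fun x => congrArg _ (hg.1 x), fun x => congrArg _ (hg.2 x)⟩

/-- Differentiation acts on Fourier coefficients as multiplication by `i kᵢ`. -/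
lemma fc_pd2 {g : P2 → ℝ} (hg : ContDiff ℝ 1 g) (hper : Per2 g) (i : Fin 2) (k : ℤ × ℤ) :
    fc (pd2 i g) k = Complex.I * freq k i * fc g k := by
  have hgC : ContDiff ℝ 1 fun x => (g x : ℂ) := Complex.ofRealCLM.contDiff.comp hg
  have hpd : Continuous (pd2 i g) :=
    (hg.continuous_fderiv one_ne_zero).clm_apply continuous_const
  have h0 := integral_fderiv_e2_eq_zero (hgC.mul (contDiff_ef (-k)))
    (hper.ofReal.mul (per2_ef (-k))) i
  have hder : ∀ x, fderiv ℝ (fun x => (g x : ℂ) * ef (-k) x) x (e2 i) =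
      (pd2 i g x : ℂ) * ef (-k) x - Complex.I * freq k i * ((g x : ℂ) * ef (-k) x) := by
    intro x
    have h1 : HasFDerivAt (fun x => (g x : ℂ)) (Complex.ofRealCLM.comp (fderiv ℝ g x)) x :=
      Complex.ofRealCLM.hasFDerivAt.comp x (hg.differentiable one_ne_zero x).hasFDerivAt
    have h2 : HasFDerivAt (fun x => (g x : ℂ) * ef (-k) x) _ x := h1.mul (hasFDerivAt_ef (-k) x)
    rw [h2.fderiv]
    have hneg : freq (-k) i = -freq k i := by fin_cases i <;> simp [freq]
    simp [phase_e2, hneg, pd2]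
    ring
  simp only [hder] at h0
  rw [integral_sub, integral_const_mul, sub_eq_zero] at h0
  · rw [fc_eq, fc_eq, h0]
    ring
  · exact integrableOn_Q2 ((Complex.continuous_ofReal.comp hpd).mul (continuous_ef _))
  · exact integrableOn_Q2 (continuous_const.mul
      ((Complex.continuous_ofReal.comp hg.continuous).mul (continuous_ef _)))

lemma integral_ef_mul_ef (j k : ℤ × ℤ) :
    ∫ x in Q2, ef j x * ef (-k) x = if j = k then ((2 * Real.pi) ^ 2 : ℂ) else 0 := by
  simp only [← ef_add, ← sub_eq_add_neg]
  split_ifs with h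
  · have hp := Real.two_pi_pos
    have : volume.real Q2 = (2 * Real.pi) ^ 2 := by
      rw [Q2, Measure.volume_eq_prod, measureReal_prod_prod]
      simp [hp.le]
      ring
    simp [h, ef_zero, this]
  · have hne : ∃ i, freq (j - k) i ≠ 0 := by
      by_contra! h0
      exact h (sub_eq_zero.mp (Prod.ext (h0 0) (h0 1)))
    obtain ⟨i, hi⟩ := hne
    have h0 := integral_fderiv_e2_eq_zero (contDiff_ef (j - k)) (per2_ef (j - k)) i
    simp only [(hasFDerivAt_ef _ _).fderiv, smul_apply, phase_e2,
      smul_eq_mul, integral_mul_const] at h0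
    simpa [hi] using h0

lemma exists_norm_fc_le (g : P2 → ℝ) : ∃ M, ∀ k, ‖fc g k‖ ≤ M := by
  refine ⟨‖((2 * Real.pi) ^ 2 : ℂ)⁻¹‖ * ∫ x in Q2, ‖g x‖, fun k => ?_⟩
  rw [fc_eq, norm_mul]
  gcongr
  refine (norm_integral_le_integral_norm _).trans_eq ?_
  simp [norm_ef]

lemma contDiff_pd2 {g : P2 → ℝ} (hg : ContDiff ℝ (⊤ : ℕ∞) g) (i : Fin 2) :
    ContDiff ℝ (⊤ : ℕ∞) (pd2 i g) :=
  (hg.fderiv_right (m := (⊤ : ℕ∞)) (by simp)).clm_apply contDiff_const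

lemma Per2.pd2 {g : P2 → ℝ} (hg : Per2 g) (i : Fin 2) : Per2 (pd2 i g) := by
  have key : ∀ v : P2, (∀ x, g (x + v) = g x) → ∀ x, _root_.pd2 i g (x + v) = _root_.pd2 i g x := by
    intro v hv x
    unfold _root_.pd2
    rw [← fderiv_comp_add_right]
    simp only [hv]
  constructor <;> intro x
  · have := key (2 * Real.pi, 0) (fun x => by rw [← hg.1 x, Prod.add_def, add_zero]) x
    rwa [Prod.add_def, add_zero] at this
  · have := key (0, 2 * Real.pi) (fun x => by rw [← hg.2 x, Prod.add_def, add_zero]) x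
    rwa [Prod.add_def, add_zero] at this

lemma one_le_wt (k : ℤ × ℤ) : 1 ≤ wt k := by
  unfold wt
  nlinarith [sq_nonneg (k.1 : ℝ), sq_nonneg (k.2 : ℝ)]

lemma wt_pos (k : ℤ × ℤ) : 0 < wt k := one_pos.trans_le (one_le_wt k)

lemma wt_eq_freq (k : ℤ × ℤ) : wt k = 1 + (freq k 0 : ℝ) ^ 2 + (freq k 1 : ℝ) ^ 2 := rfl

/-- Fourier coefficients of a smooth function decay faster than any power. -/
lemma exists_wt_pow_mul_norm_fc_le (N : ℕ) : ∀ {g : P2 → ℝ}, ContDiff ℝ (⊤ : ℕ∞) g → Per2 g →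
    ∃ M, ∀ k, wt k ^ N * ‖fc g k‖ ≤ M := by
  induction N with
  | zero =>
    intro g _ _
    simpa using exists_norm_fc_le g
  | succ N ih =>
    intro g hg hper
    have hnorm : ∀ i k, ‖fc (pd2 i (pd2 i g)) k‖ = (freq k i : ℝ) ^ 2 * ‖fc g k‖ := by
      intro i k
      rw [fc_pd2 ((contDiff_pd2 hg i).of_le (by exact_mod_cast le_top)) (hper.pd2 i),
        fc_pd2 (hg.of_le (by exact_mod_cast le_top)) hper]
      simp only [norm_mul, Complex.norm_I, Complex.norm_intCast, ← sq_abs (freq k i : ℝ)]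
      ring
    obtain ⟨M, hM⟩ := ih hg hper
    obtain ⟨M₀, hM₀⟩ := ih (contDiff_pd2 (contDiff_pd2 hg 0) 0) ((hper.pd2 0).pd2 0)
    obtain ⟨M₁, hM₁⟩ := ih (contDiff_pd2 (contDiff_pd2 hg 1) 1) ((hper.pd2 1).pd2 1)
    refine ⟨M + M₀ + M₁, fun k => ?_⟩
    have h0 := hM₀ k
    have h1 := hM₁ k
    rw [hnorm] at h0 h1
    calc wt k ^ (N + 1) * ‖fc g k‖
        = wt k ^ N * ‖fc g k‖ + wt k ^ N * ((freq k 0 : ℝ) ^ 2 * ‖fc g k‖)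
          + wt k ^ N * ((freq k 1 : ℝ) ^ 2 * ‖fc g k‖) := by
          rw [pow_succ]
          conv_lhs => rw [mul_assoc, wt_eq_freq k, ← wt_eq_freq k]
          nth_rw 2 [wt_eq_freq]
          ring
      _ ≤ M + M₀ + M₁ := add_le_add (add_le_add (hM k) h0) h1

lemma summable_inv_wt_sq : Summable fun k => (wt k ^ 2)⁻¹ := by
  have h1 : Summable fun n : ℤ => (1 + (n : ℝ) ^ 2)⁻¹ := by
    refine Summable.of_norm_bounded_eventually
      (Real.summable_one_div_int_pow.mpr (le_refl 2)) ?_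
    filter_upwards [(Set.finite_singleton (0 : ℤ)).compl_mem_cofinite] with n hn
    have hn' : (n : ℝ) ≠ 0 := by exact_mod_cast hn
    rw [Real.norm_of_nonneg (by positivity), one_div]
    gcongr
    linarith
  refine Summable.of_nonneg_of_le (fun k => by positivity) (fun k => ?_)
    (h1.mul_of_nonneg h1 (fun n => by positivity) (fun n => by positivity))
  rw [← mul_inv]
  gcongr
  unfold wt
  nlinarith [sq_nonneg (k.1 : ℝ), sq_nonneg (k.2 : ℝ),
    mul_nonneg (sq_nonneg (k.1 : ℝ)) (sq_nonneg (k.2 : ℝ))]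

lemma summable_wt_rpow_mul_norm_fc {g : P2 → ℝ} (hg : ContDiff ℝ (⊤ : ℕ∞) g) (hper : Per2 g)
    (r : ℝ) : Summable fun k => wt k ^ r * ‖fc g k‖ := by
  obtain ⟨n, hn⟩ := exists_nat_ge r
  obtain ⟨M, hM⟩ := exists_wt_pow_mul_norm_fc_le (n + 2) hg hper
  refine Summable.of_nonneg_of_le (fun k => mul_nonneg (Real.rpow_nonneg (wt_pos k).le _)
    (norm_nonneg _)) (fun k => ?_) (summable_inv_wt_sq.mul_right M)
  have hw := wt_pos k
  have h1 : wt k ^ r ≤ wt k ^ n := by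
    rw [← Real.rpow_natCast]
    exact Real.rpow_le_rpow_of_exponent_le (one_le_wt k) hn
  calc wt k ^ r * ‖fc g k‖ ≤ wt k ^ n * ‖fc g k‖ := by gcongr
    _ = (wt k ^ 2)⁻¹ * (wt k ^ (n + 2) * ‖fc g k‖) := by
      rw [pow_add]
      field_simp
    _ ≤ (wt k ^ 2)⁻¹ * M := by
      gcongr
      exact hM k

lemma norm_phase_le (k : ℤ × ℤ) : ‖phase k‖ ≤ wt k := by
  refine ContinuousLinearMap.opNorm_le_bound _ (wt_pos k).le fun x => ?_
  have h1 : |x.1| ≤ ‖x‖ := norm_fst_le x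
  have h2 : |x.2| ≤ ‖x‖ := norm_snd_le x
  have hk : |(k.1 : ℝ)| + |(k.2 : ℝ)| ≤ wt k := by
    unfold wt
    rw [← sq_abs (k.1 : ℝ), ← sq_abs (k.2 : ℝ)]
    nlinarith [sq_nonneg (|(k.1 : ℝ)| - 1 / 2), sq_nonneg (|(k.2 : ℝ)| - 1 / 2)]
  calc ‖phase k x‖ ≤ |(k.1 : ℝ)| * |x.1| + |(k.2 : ℝ)| * |x.2| := by
        rw [phase_apply, norm_mul, Complex.norm_I, one_mul]
        refine (norm_add_le _ _).trans_eq ?_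
        simp
    _ ≤ |(k.1 : ℝ)| * ‖x‖ + |(k.2 : ℝ)| * ‖x‖ := by gcongr
    _ = (|(k.1 : ℝ)| + |(k.2 : ℝ)|) * ‖x‖ := by ring
    _ ≤ wt k * ‖x‖ := by gcongr

lemma contDiff_one_tsum_ef {c : ℤ × ℤ → ℂ} (hc : Summable fun k => wt k * ‖c k‖) :
    ContDiff ℝ 1 fun x => ∑' k, c k * ef k x := by
  refine contDiff_tsum (N := 1) (v := fun _ k => wt k * ‖c k‖)
    (fun k => contDiff_const.mul (contDiff_ef k)) (fun _ _ => hc) fun m k x hm => ?_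
  have hm' : m ≤ 1 := by exact_mod_cast hm
  interval_cases m
  · rw [norm_iteratedFDeriv_zero, norm_mul, norm_ef, mul_one]
    exact le_mul_of_one_le_left (norm_nonneg _) (one_le_wt k)
  · rw [norm_iteratedFDeriv_one, ((hasFDerivAt_ef k x).const_mul (c k)).fderiv, norm_smul,
      norm_smul, norm_ef, one_mul, mul_comm]
    gcongr
    exact norm_phase_le k

lemma integral_tsum_ef_mul_ef {c : ℤ × ℤ → ℂ} (hc : Summable fun k => ‖c k‖) (k : ℤ × ℤ) :
    ∫ x in Q2, (∑' j, c j * ef j x) * ef (-k) x = (2 * Real.pi) ^ 2 * c k := by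
  have hint : ∀ j, IntegrableOn (fun x => c j * ef j x * ef (-k) x) Q2 := fun j =>
    integrableOn_Q2 ((continuous_const.mul (continuous_ef j)).mul (continuous_ef _))
  have hnorm : Summable fun j => ∫ x in Q2, ‖c j * ef j x * ef (-k) x‖ := by
    simpa [norm_ef] using hc.mul_left (volume.real Q2)
  have h := hasSum_integral_of_summable_integral_norm hint hnorm
  simp only [mul_assoc, integral_const_mul, integral_ef_mul_ef] at h
  simp only [← mul_assoc, tsum_mul_right] at h
  rw [← h.tsum_eq, tsum_eq_single k (fun j hj => by simp [hj])]
  simp [mul_comm]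

lemma fc_neg (g : P2 → ℝ) (k : ℤ × ℤ) : fc g (-k) = (starRingEnd ℂ) (fc g k) := by
  rw [fc_eq, fc_eq, map_mul, ← integral_conj]
  simp [ef_neg, map_ofNat]

lemma wt_neg (k : ℤ × ℤ) : wt (-k) = wt k := by simp [wt]

/-- The Fourier coefficients of `⟨∇⟩^σ g`. -/
def jc (σ : ℝ) (g : P2 → ℝ) (k : ℤ × ℤ) : ℂ := ((wt k ^ (σ / 2) : ℝ) : ℂ) * fc g k

lemma norm_jc (σ : ℝ) (g : P2 → ℝ) (k : ℤ × ℤ) : ‖jc σ g k‖ = wt k ^ (σ / 2) * ‖fc g k‖ := by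
  rw [jc, norm_mul, Complex.norm_real, Real.norm_of_nonneg (Real.rpow_nonneg (wt_pos k).le _)]

lemma norm_jc_sq (σ : ℝ) (g : P2 → ℝ) (k : ℤ × ℤ) :
    ‖jc σ g k‖ ^ 2 = wt k ^ σ * ‖fc g k‖ ^ 2 := by
  rw [norm_jc, mul_pow, ← Real.rpow_natCast, ← Real.rpow_mul (wt_pos k).le]
  norm_num

lemma Jop_eq_re (σ : ℝ) (g : P2 → ℝ) (x : P2) : Jop σ g x = (∑' k, jc σ g k * ef k x).re := rfl

lemma ofReal_Jop (σ : ℝ) (g : P2 → ℝ) (x : P2) :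
    (Jop σ g x : ℂ) = ∑' k, jc σ g k * ef k x := by
  rw [Jop_eq_re]
  refine Complex.conj_eq_iff_re.mp ?_
  rw [Complex.conj_tsum, ← (Equiv.neg (ℤ × ℤ)).tsum_eq]
  refine tsum_congr fun k => ?_
  simp [jc, fc_neg, ef_neg, wt_neg]

lemma per2_Jop (σ : ℝ) (g : P2 → ℝ) : Per2 (Jop σ g) := by
  constructor <;> intro x <;> simp only [Jop_eq_re, (per2_ef _).1 x, (per2_ef _).2 x]

lemma contDiff_one_Jop {g : P2 → ℝ} (hg : ContDiff ℝ (⊤ : ℕ∞) g) (hper : Per2 g)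
    (σ : ℝ) : ContDiff ℝ 1 (Jop σ g) := by
  refine Complex.reCLM.contDiff.comp (contDiff_one_tsum_ef (c := jc σ g) ?_)
  refine (summable_wt_rpow_mul_norm_fc hg hper (1 + σ / 2)).congr fun k => ?_
  rw [norm_jc, Real.rpow_add (wt_pos k), Real.rpow_one, mul_assoc]

lemma fc_Jop {g : P2 → ℝ} (hg : ContDiff ℝ (⊤ : ℕ∞) g) (hper : Per2 g)
    (σ : ℝ) (k : ℤ × ℤ) : fc (Jop σ g) k = jc σ g k := by
  have hs : Summable fun k => ‖jc σ g k‖ := by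
    simpa only [norm_jc] using summable_wt_rpow_mul_norm_fc hg hper (σ / 2)
  rw [fc_eq]
  simp only [ofReal_Jop]
  rw [integral_tsum_ef_mul_ef hs, ← mul_assoc, inv_mul_cancel₀, one_mul]
  exact pow_ne_zero _ (by exact_mod_cast Real.two_pi_pos.ne')

lemma L2Sq_Jop {g : P2 → ℝ} (hg : ContDiff ℝ (⊤ : ℕ∞) g) (hper : Per2 g)
    (σ : ℝ) : L2Sq (Jop σ g) = HSq σ g :=
  tsum_congr fun k => by rw [fc_Jop hg hper, norm_jc_sq]

lemma continuous_pd2_Jop {g : P2 → ℝ} (hg : ContDiff ℝ (⊤ : ℕ∞) g) (hper : Per2 g)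
    (σ : ℝ) (i : Fin 2) : Continuous (pd2 i (Jop σ g)) :=
  ((contDiff_one_Jop hg hper σ).continuous_fderiv one_ne_zero).clm_apply continuous_const

lemma hasSum_pd2_Jop {g : P2 → ℝ} (hg : ContDiff ℝ (⊤ : ℕ∞) g) (hper : Per2 g)
    (σ : ℝ) (i : Fin 2) :
    HasSum (fun k => (freq k i : ℝ) ^ 2 * (wt k ^ σ * ‖fc g k‖ ^ 2))
      (L2Sq (pd2 i (Jop σ g))) := by
  have h := hasSum_norm_fc_sq (continuous_pd2_Jop hg hper σ i)
  rw [← L2Sq_eq (continuous_pd2_Jop hg hper σ i)] at h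
  refine h.congr_fun fun k => ?_
  rw [fc_pd2 (contDiff_one_Jop hg hper σ) (per2_Jop σ g), fc_Jop hg hper, ← norm_jc_sq,
    norm_mul, norm_mul, Complex.norm_I, Complex.norm_intCast, one_mul, mul_pow, sq_abs]

/-- The top-order Sobolev norm is controlled by the gradient of `⟨∇⟩^σ g` and the `L²` norm. -/
lemma HSq_add_one_le {g : P2 → ℝ} (hg : ContDiff ℝ (⊤ : ℕ∞) g) (hper : Per2 g)
    (σ : ℝ) :
    HSq (σ + 1) g ≤ 2 * (L2Sq (pd2 0 (Jop σ g)) + L2Sq (pd2 1 (Jop σ g))) + L2Sq g := by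
  have hL : HasSum (fun k => ‖fc g k‖ ^ 2) (L2Sq g) := by
    rw [L2Sq_eq hg.continuous]
    exact hasSum_norm_fc_sq hg.continuous
  have h := (((hasSum_pd2_Jop hg hper σ 0).add (hasSum_pd2_Jop hg hper σ 1)).mul_left 2).add hL
  have hle : ∀ k, wt k ^ (σ + 1) * ‖fc g k‖ ^ 2 ≤
      2 * ((freq k 0 : ℝ) ^ 2 * (wt k ^ σ * ‖fc g k‖ ^ 2) +
        (freq k 1 : ℝ) ^ 2 * (wt k ^ σ * ‖fc g k‖ ^ 2)) + ‖fc g k‖ ^ 2 := by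
    intro k
    have hu := sq_nonneg ‖fc g k‖
    by_cases hk : k = 0
    · subst hk
      simp [wt, freq]
    have hint : 1 ≤ freq k 0 ^ 2 + freq k 1 ^ 2 := by
      by_contra! hlt
      have h0 : freq k 0 = 0 := by nlinarith [sq_nonneg (freq k 0), sq_nonneg (freq k 1)]
      have h1 : freq k 1 = 0 := by nlinarith [sq_nonneg (freq k 0), sq_nonneg (freq k 1)]
      exact hk (Prod.ext h0 h1)
    have hreal : 1 ≤ (freq k 0 : ℝ) ^ 2 + (freq k 1 : ℝ) ^ 2 := by exact_mod_cast hint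
    have hv : 0 ≤ wt k ^ σ * ‖fc g k‖ ^ 2 := mul_nonneg (Real.rpow_nonneg (wt_pos k).le _) hu
    calc wt k ^ (σ + 1) * ‖fc g k‖ ^ 2
        = (1 + (freq k 0 : ℝ) ^ 2 + (freq k 1 : ℝ) ^ 2) * (wt k ^ σ * ‖fc g k‖ ^ 2) := by
          rw [Real.rpow_add (wt_pos k), Real.rpow_one, ← wt_eq_freq]
          ring
      _ ≤ _ := by nlinarith
  have hs : Summable fun k => wt k ^ (σ + 1) * ‖fc g k‖ ^ 2 :=
    Summable.of_nonneg_of_le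
      (fun k => mul_nonneg (Real.rpow_nonneg (wt_pos k).le _) (sq_nonneg _)) hle h.summable
  exact hasSum_le hle hs.hasSum h

lemma L2Sq_comb_le {p q r t : P2 → ℝ} (hp : Continuous p) (hq : Continuous q)
    (hr : Continuous r) (ht : Continuous t) {α β γ δ : ℝ}
    (h : ∀ x, α * p x ^ 2 + β * q x ^ 2 ≤ γ * r x ^ 2 + δ * t x ^ 2) :
    α * L2Sq p + β * L2Sq q ≤ γ * L2Sq r + δ * L2Sq t := by
  have hi : ∀ {u : P2 → ℝ} (c : ℝ), Continuous u → IntegrableOn (fun x => c * u x ^ 2) Q2 :=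
    fun c hu => integrableOn_Q2 (continuous_const.mul (hu.pow 2))
  have hmono : ∫ x in Q2, (α * p x ^ 2 + β * q x ^ 2) ≤ ∫ x in Q2, (γ * r x ^ 2 + δ * t x ^ 2) :=
    integral_mono ((hi α hp).add (hi β hq)) ((hi γ hr).add (hi δ ht)) h
  rw [integral_add (hi α hp) (hi β hq), integral_add (hi γ hr) (hi δ ht)] at hmono
  simp only [integral_const_mul] at hmono
  rw [L2Sq_eq hp, L2Sq_eq hq, L2Sq_eq hr, L2Sq_eq ht]
  have hpos : 0 ≤ ((2 * Real.pi) ^ 2)⁻¹ := by positivity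
  nlinarith [mul_le_mul_of_nonneg_left hmono hpos]

/-- The stability condition implies the equivalence of the energy functional E_s with the
standard Sobolev energy: ‖f‖²_{H^{s+1/2}} + ‖θ‖²_{H^{s−1/2}} is controlled by
E_s + ‖θ‖²_{L²} + ‖f‖²_{L²}, with a constant depending only on s, c₁, L₀. -/
theorem energy_controls_sobolev_norm
    (s : ℕ) (hs : 3 ≤ s) (c₁ L₀ : ℝ) (hc₁ : 0 < c₁) (hL₀ : 0 < L₀) :
    ∃ C : ℝ, 0 < C ∧
      ∀ a b bh : P2 → P2,
        Continuous a → Continuous b → Continuous bh →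
        Per2 a → Per2 b → Per2 bh →
        (∀ x : P2, ‖a x‖ ≤ L₀) → (∀ x : P2, ‖b x‖ ≤ L₀) → (∀ x : P2, ‖bh x‖ ≤ L₀) →
        (∀ x ξ : P2, c₁ * (ξ.1 ^ 2 + ξ.2 ^ 2) ≤ (dot2 (b x) ξ) ^ 2 + (dot2 (bh x) ξ) ^ 2) →
        ∀ f θ : P2 → ℝ,
          ContDiff ℝ (⊤ : ℕ∞) f → ContDiff ℝ (⊤ : ℕ∞) θ → Per2 f → Per2 θ →
          HSq ((s : ℝ) + 1 / 2) f + HSq ((s : ℝ) - 1 / 2) θ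
            ≤ C * (L2Sq (fun x => Jop ((s : ℝ) - 1 / 2) θ x
                      + (a x).1 * pd2 0 (Jop ((s : ℝ) - 1 / 2) f) x
                      + (a x).2 * pd2 1 (Jop ((s : ℝ) - 1 / 2) f) x)
                + (1 / 2) * L2Sq (fun x => (b x).1 * pd2 0 (Jop ((s : ℝ) - 1 / 2) f) x
                      + (b x).2 * pd2 1 (Jop ((s : ℝ) - 1 / 2) f) x)
                + (1 / 2) * L2Sq (fun x => (bh x).1 * pd2 0 (Jop ((s : ℝ) - 1 / 2) f) x
                      + (bh x).2 * pd2 1 (Jop ((s : ℝ) - 1 / 2) f) x)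
                + L2Sq θ + L2Sq f) := by
  refine ⟨2 + 2 * ((2 + 4 * L₀ ^ 2) / c₁), by positivity, ?_⟩
  intro a b bh ha hb hbh _ _ _ haL _ _ hstab f θ hf hθ hfp hθp
  have hσ : (s : ℝ) + 1 / 2 = ((s : ℝ) - 1 / 2) + 1 := by ring
  rw [hσ]
  set σ : ℝ := (s : ℝ) - 1 / 2
  set p := pd2 0 (Jop σ f)
  set q := pd2 1 (Jop σ f)
  have hp : Continuous p := continuous_pd2_Jop hf hfp σ 0
  have hq : Continuous q := continuous_pd2_Jop hf hfp σ 1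
  have hJ : Continuous (Jop σ θ) := (contDiff_one_Jop hθ hθp σ).continuous
  have hf_le : HSq (σ + 1) f ≤ 2 * (L2Sq p + L2Sq q) + L2Sq f := HSq_add_one_le hf hfp σ
  rw [← L2Sq_Jop hθ hθp]
  have hA : Continuous fun x => Jop σ θ x + (a x).1 * p x + (a x).2 * q x := by fun_prop
  have hB : Continuous fun x => (b x).1 * p x + (b x).2 * q x := by fun_prop
  have hBh : Continuous fun x => (bh x).1 * p x + (bh x).2 * q x := by fun_prop
  have hgrad := L2Sq_comb_le hp hq hB hBh (α := c₁) (β := c₁) (γ := 1) (δ := 1) fun x => by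
    have := hstab x (p x, q x)
    simp only [dot2] at this
    linarith
  have hθ_le := L2Sq_comb_le hJ hA hp hq (α := 1) (β := -2) (γ := 4 * L₀ ^ 2)
      (δ := 4 * L₀ ^ 2) fun x => by
    have h1 : (a x).1 ^ 2 ≤ L₀ ^ 2 :=
      sq_le_sq' (abs_le.mp ((norm_fst_le (a x)).trans (haL x))).1
        (abs_le.mp ((norm_fst_le (a x)).trans (haL x))).2
    have h2 : (a x).2 ^ 2 ≤ L₀ ^ 2 :=
      sq_le_sq' (abs_le.mp ((norm_snd_le (a x)).trans (haL x))).1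
        (abs_le.mp ((norm_snd_le (a x)).trans (haL x))).2
    have h3 := mul_le_mul_of_nonneg_right h1 (sq_nonneg (p x))
    have h4 := mul_le_mul_of_nonneg_right h2 (sq_nonneg (q x))
    nlinarith [sq_nonneg (Jop σ θ x + 2 * ((a x).1 * p x + (a x).2 * q x)),
      sq_nonneg ((a x).1 * p x - (a x).2 * q x)]
  have hnn : ∀ u : P2 → ℝ, 0 ≤ L2Sq u := fun u => tsum_nonneg fun k => sq_nonneg _
  have hA0 := hnn fun x => Jop σ θ x + (a x).1 * p x + (a x).2 * q x
  have hB0 := hnn fun x => (b x).1 * p x + (b x).2 * q x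
  have hBh0 := hnn fun x => (bh x).1 * p x + (bh x).2 * q x
  have hf0 := hnn f
  have hθ0 := hnn θ
  set A := L2Sq fun x => Jop σ θ x + (a x).1 * p x + (a x).2 * q x
  set B := L2Sq fun x => (b x).1 * p x + (b x).2 * q x
  set Bh := L2Sq fun x => (bh x).1 * p x + (bh x).2 * q x
  have hsum : L2Sq p + L2Sq q ≤ (B + Bh) / c₁ := by
    rw [le_div_iff₀ hc₁]
    linarith
  have hK : 0 ≤ (2 + 4 * L₀ ^ 2) / c₁ := by positivity
  have hmul : (2 + 4 * L₀ ^ 2) * (L2Sq p + L2Sq q) ≤ (2 + 4 * L₀ ^ 2) / c₁ * (B + Bh) := by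
    rw [div_mul_eq_mul_div, ← mul_div_assoc']
    exact mul_le_mul_of_nonneg_left hsum (by positivity)
  generalize (2 + 4 * L₀ ^ 2) / c₁ = K at hK hmul ⊢
  nlinarith [mul_nonneg hK hA0, mul_nonneg hK hf0, mul_nonneg hK hθ0]

end
end
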